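/- arXiv:2103.07469 — 2 statements merged into one kernel-verified Lean document; each statement's English description precedes it below -/
import Mathlib

section
/- With K_A ⊆ V_A and K_B ⊆ V_B as in the GPT setup, the minimal and maximal tensor products coincide, K_A ⊗min K_B = K_A ⊗max K_B, if and only if K_A or K_B is a simplex, i.e., if and only if the set of extreme points of K_A is linearly independent or the set of extreme points of K_B is linearly independent. -/
open TensorProduct

/-- The linear functional `f ⊗ g` on `V ⊗ W` induced by linear functionals `f, g`. -/
noncomputable def tensorFunctional {V W : Type*} [AddCommGroup V] [Module ℝ V]
    [AddCommGroup W] [Module ℝ W] (f : V →ₗ[ℝ] ℝ) (g : W →ₗ[ℝ] ℝ) :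
    V ⊗[ℝ] W →ₗ[ℝ] ℝ :=
  TensorProduct.lift ((LinearMap.mul ℝ ℝ).compl₁₂ f g)

/-- The minimal tensor product of two state spaces. -/
noncomputable def minTensor {V W : Type*} [AddCommGroup V] [Module ℝ V]
    [AddCommGroup W] [Module ℝ W] (K : Set V) (L : Set W) : Set (V ⊗[ℝ] W) :=
  convexHull ℝ {z | ∃ x ∈ K, ∃ y ∈ L, z = x ⊗ₜ[ℝ] y}

/-- The maximal tensor product of two state spaces with unit functionals `eK, eL`. -/
noncomputable def maxTensor {V W : Type*} [AddCommGroup V] [Module ℝ V]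
    [AddCommGroup W] [Module ℝ W] (K : Set V) (L : Set W)
    (eK : V →ₗ[ℝ] ℝ) (eL : W →ₗ[ℝ] ℝ) : Set (V ⊗[ℝ] W) :=
  {z | (∀ f : V →ₗ[ℝ] ℝ, ∀ g : W →ₗ[ℝ] ℝ, (∀ x ∈ K, 0 ≤ f x ∧ f x ≤ 1) →
        (∀ y ∈ L, 0 ≤ g y ∧ g y ≤ 1) → 0 ≤ tensorFunctional f g z) ∧
      tensorFunctional eK eL z = 1}

namespace ConeTensor

open scoped RealInnerProductSpace

section

variable {V W : Type*} [NormedAddCommGroup V] [InnerProductSpace ℝ V]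
  [NormedAddCommGroup W] [InnerProductSpace ℝ W]

/-- Closed convex cones, as sets. -/
structure IsClosedCone (C : Set V) : Prop where
  isClosed : IsClosed C
  zero_mem : (0 : V) ∈ C
  add_mem : ∀ {x y}, x ∈ C → y ∈ C → x + y ∈ C
  smul_mem : ∀ {t : ℝ} {x}, 0 ≤ t → x ∈ C → t • x ∈ C

/-- Closed convex cones which are spanning and pointed. -/
structure IsProperCone (C : Set V) : Prop extends IsClosedCone C where
  span_eq_top : Submodule.span ℝ C = ⊤
  exists_pos : ∃ e : V, ∀ x ∈ C, x ≠ 0 → 0 < ⟪e, x⟫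

/-- The dual cone, with functionals represented through the inner product. -/
def dualCone (C : Set V) : Set V := {f | ∀ x ∈ C, 0 ≤ ⟪f, x⟫}

theorem hull_induction {E : Type*} [AddCommGroup E] [Module ℝ E] {S : Set E} {P : E → Prop}
    (mem : ∀ x ∈ S, P x) (zero : P 0) (add : ∀ x y, P x → P y → P (x + y))
    (smul : ∀ (c : ℝ) x, 0 ≤ c → P x → P (c • x)) {x : E} (hx : x ∈ PointedCone.hull ℝ S) :
    P x :=
  Submodule.span_induction (p := fun x _ => P x) mem zero (fun x y _ _ => add x y)
    (fun c x _ => smul c.1 x c.2) hx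

theorem smul_mem_hull {E : Type*} [AddCommGroup E] [Module ℝ E] {S : Set E} {c : ℝ} {x : E}
    (hc : 0 ≤ c) (hx : x ∈ PointedCone.hull ℝ S) : c • x ∈ PointedCone.hull ℝ S :=
  (PointedCone.hull ℝ S).smul_mem hc hx

theorem isClosedCone_dualCone (C : Set V) : IsClosedCone (dualCone C) where
  isClosed := by
    have : dualCone C = ⋂ x ∈ C, {f : V | 0 ≤ ⟪f, x⟫} := by ext; simp [dualCone]
    rw [this]
    exact isClosed_biInter fun x _ => isClosed_le continuous_const (by fun_prop)
  zero_mem := fun x _ => by simp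
  add_mem := fun hf hg x hx => by
    rw [inner_add_left]; exact add_nonneg (hf x hx) (hg x hx)
  smul_mem := fun ht hf x hx => by
    rw [real_inner_smul_left]; exact mul_nonneg ht (hf x hx)

theorem IsClosedCone.exists_neg [CompleteSpace V] {C : Set V} (hC : IsClosedCone C) {x : V}
    (hx : x ∉ C) : ∃ f ∈ dualCone C, ⟪f, x⟫ < 0 := by
  let P : ProperCone ℝ V :=
    { carrier := C
      add_mem' := hC.add_mem
      zero_mem' := hC.zero_mem
      smul_mem' := fun c x hx => hC.smul_mem c.2 hx
      isClosed' := hC.isClosed }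
  obtain ⟨y, hy, hy'⟩ := P.hyperplane_separation' (x₀ := x) hx
  exact ⟨y, fun z hz => by rw [real_inner_comm]; exact hy z hz, by rwa [real_inner_comm]⟩

theorem IsClosedCone.mem_of_dual [CompleteSpace V] {C : Set V} (hC : IsClosedCone C) {x : V}
    (h : ∀ f ∈ dualCone C, 0 ≤ ⟪f, x⟫) : x ∈ C := by
  by_contra hx
  obtain ⟨f, hf, hf'⟩ := hC.exists_neg hx
  exact absurd (h f hf) (not_le.2 hf')

theorem IsClosedCone.dualCone_dualCone [CompleteSpace V] {C : Set V} (hC : IsClosedCone C) :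
    dualCone (dualCone C) = C := by
  refine Set.Subset.antisymm (fun x hx => hC.mem_of_dual fun f hf => ?_) fun x hx f hf => ?_
  · rw [real_inner_comm]; exact hx f hf
  · rw [real_inner_comm]; exact hf x hx

variable [FiniteDimensional ℝ V] [FiniteDimensional ℝ W]

/-- A vector positive on a spanning cone's dual. -/
theorem exists_pos_dualCone {C : Set V} (hC : IsProperCone C) :
    ∃ u ∈ C, ∀ f ∈ dualCone C, f ≠ 0 → 0 < ⟪f, u⟫ := by
  obtain ⟨t, htC, ht⟩ := (Submodule.fg_span_iff_fg_span_finset_subset (R := ℝ) C).1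
    (IsNoetherian.noetherian _)
  rw [hC.span_eq_top] at ht
  have hmem : ∀ s : Finset V, (s : Set V) ⊆ C → ∑ x ∈ s, x ∈ C := by
    intro s hs
    classical
    induction s using Finset.induction_on with
    | empty => simpa using hC.zero_mem
    | insert a s ha ih =>
      rw [Finset.sum_insert ha]
      exact hC.add_mem (hs (by simp)) (ih fun x hx => hs (by simp [hx]))
  refine ⟨∑ x ∈ t, x, hmem t htC, fun f hf hf0 => ?_⟩
  rw [inner_sum]
  refine lt_of_le_of_ne (Finset.sum_nonneg fun x hx => hf x (htC hx)) fun h => hf0 ?_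
  have h0 := (Finset.sum_eq_zero_iff_of_nonneg fun x hx => hf x (htC hx)).1 h.symm
  have : (⊤ : Submodule ℝ V) ≤ LinearMap.ker (innerₗ V f) := by
    rw [ht, Submodule.span_le]
    intro x hx
    simpa using h0 x hx
  have := this (Submodule.mem_top (x := f))
  simpa using this

theorem IsProperCone.dual {C : Set V} (hC : IsProperCone C) : IsProperCone (dualCone C) where
  toIsClosedCone := isClosedCone_dualCone C
  span_eq_top := by
    by_contra h
    obtain ⟨v, hv, hv0⟩ := (Submodule.ne_bot_iff _).1
      (mt (Submodule.orthogonal_eq_bot_iff).1 h)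
    have h1 : ∀ f ∈ dualCone C, ⟪f, v⟫ = 0 := fun f hf =>
      (Submodule.mem_orthogonal _ _).1 hv f (Submodule.subset_span hf)
    have h2 : v ∈ C := hC.mem_of_dual fun f hf => (h1 f hf).ge
    have h3 : -v ∈ C := hC.mem_of_dual fun f hf => by simp [h1 f hf]
    obtain ⟨e, he⟩ := hC.exists_pos
    have h4 := he v h2 hv0
    have h5 := he (-v) h3 (neg_ne_zero.2 hv0)
    rw [inner_neg_right] at h5
    linarith
  exists_pos := by
    obtain ⟨u, -, hu⟩ := exists_pos_dualCone hC
    exact ⟨u, fun f hf hf0 => by rw [real_inner_comm]; exact hu f hf hf0⟩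

theorem isCompact_base {C : Set V} (hC : IsClosedCone C) {e : V}
    (he : ∀ x ∈ C, x ≠ 0 → 0 < ⟪e, x⟫) : IsCompact {x ∈ C | ⟪e, x⟫ = 1} := by
  have hcl : IsClosed {x ∈ C | ⟪e, x⟫ = 1} :=
    hC.isClosed.inter (isClosed_eq (by fun_prop) continuous_const)
  have hS : IsCompact (C ∩ Metric.sphere (0 : V) 1) :=
    (isCompact_sphere (0 : V) 1).inter_left hC.isClosed
  obtain hemp | hne := (C ∩ Metric.sphere (0 : V) 1).eq_empty_or_nonempty
  · have : {x ∈ C | ⟪e, x⟫ = 1} = ∅ := by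
      ext x
      simp only [Set.mem_ofPred_eq, Set.mem_empty_iff_false, iff_false, not_and]
      intro hx h1
      have hx0 : x ≠ 0 := by rintro rfl; simp at h1
      have : (‖x‖⁻¹ • x) ∈ C ∩ Metric.sphere (0 : V) 1 :=
        ⟨hC.smul_mem (by positivity) hx, by simp [norm_smul, hx0]⟩
      simp [hemp] at this
    rw [this]; exact isCompact_empty
  · obtain ⟨m, hm, hmin⟩ := hS.exists_isMinOn hne
      (f := fun x => ⟪e, x⟫) (by fun_prop)
    have hm0 : m ≠ 0 := by rintro rfl; simpa using hm.2
    have hpos := he m hm.1 hm0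
    refine Metric.isCompact_of_isClosed_isBounded hcl
      ((Metric.isBounded_closedBall (x := (0 : V)) (r := ⟪e, m⟫⁻¹)).subset ?_)
    rintro x ⟨hx, h1⟩
    have hx0 : x ≠ 0 := by rintro rfl; simp at h1
    have hnx : 0 < ‖x‖ := norm_pos_iff.2 hx0
    have h2 : ⟪e, m⟫ ≤ ⟪e, ‖x‖⁻¹ • x⟫ := hmin
      ⟨hC.smul_mem (by positivity) hx, by simp [norm_smul, hx0]⟩
    rw [real_inner_smul_right, h1, mul_one] at h2
    rw [mem_closedBall_zero_iff]
    exact (le_inv_comm₀ hnx hpos).2 h2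

omit [FiniteDimensional ℝ V] in
theorem isClosed_cone_over {K : Set V} (hK : IsCompact K) (e : V) (he : ∀ x ∈ K, ⟪e, x⟫ = 1) :
    IsClosed {v : V | ∃ t : ℝ, 0 ≤ t ∧ ∃ x ∈ K, v = t • x} := by
  rw [← closure_subset_iff_isClosed]
  intro z hz
  set T := ⟪e, z⟫ + 1
  have hcomp : IsCompact ((fun q : ℝ × V => q.1 • q.2) '' (Set.Icc 0 T ×ˢ K)) :=
    (isCompact_Icc.prod hK).image (by fun_prop)
  have hopen : IsOpen {v : V | ⟪e, v⟫ < T} := isOpen_lt (by fun_prop) continuous_const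
  have hz' : z ∈ closure ({v : V | ⟪e, v⟫ < T} ∩ {v : V | ∃ t : ℝ, 0 ≤ t ∧ ∃ x ∈ K, v = t • x}) :=
    hopen.inter_closure ⟨by simp [T], hz⟩
  have hsub : {v : V | ⟪e, v⟫ < T} ∩ {v : V | ∃ t : ℝ, 0 ≤ t ∧ ∃ x ∈ K, v = t • x} ⊆
      (fun q : ℝ × V => q.1 • q.2) '' (Set.Icc 0 T ×ˢ K) := by
    rintro _ ⟨h1, t, ht, x, hx, rfl⟩
    refine ⟨(t, x), ⟨⟨ht, ?_⟩, hx⟩, rfl⟩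
    simp only [Set.mem_ofPred_eq, real_inner_smul_right, he x hx, mul_one] at h1
    exact h1.le
  obtain ⟨⟨t, x⟩, ⟨⟨ht, -⟩, hx⟩, h⟩ := closure_minimal hsub hcomp.isClosed hz'
  exact ⟨t, ht, x, hx, h.symm⟩

theorem isCompact_convexHull {S : Set V} (hS : IsCompact S) : IsCompact (convexHull ℝ S) := by
  obtain rfl | ⟨s₀, hs₀⟩ := S.eq_empty_or_nonempty
  · simp
  set n := Module.finrank ℝ V + 1
  have hcomp : IsCompact ((fun q : (Fin n → ℝ) × (Fin n → V) => ∑ i, q.1 i • q.2 i) ''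
      (stdSimplex ℝ (Fin n) ×ˢ Set.univ.pi fun _ => S)) :=
    ((isCompact_stdSimplex ℝ (Fin n)).prod (isCompact_univ_pi fun _ => hS)).image (by fun_prop)
  convert hcomp
  ext x
  constructor
  · intro hx
    obtain ⟨ι, _, z, w, hz, haff, hw, hw1, rfl⟩ := eq_pos_convex_span_of_mem_convexHull hx
    classical
    have hcard : Fintype.card ι ≤ Fintype.card (Fin n) := by
      have := haff.card_le_finrank_succ
      have h2 := Submodule.finrank_le (vectorSpan ℝ (Set.range z))
      simp only [Fintype.card_fin, n]; omega
    obtain ⟨φ⟩ := Function.Embedding.nonempty_of_card_le hcard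
    refine ⟨(fun j => ∑ i, if φ i = j then w i else 0,
      fun j => if h : ∃ i, φ i = j then z h.choose else s₀), ⟨⟨fun j => ?_, ?_⟩, ?_⟩, ?_⟩
    · exact Finset.sum_nonneg fun i _ => by split_ifs <;> [exact (hw i).le; exact le_rfl]
    · rw [Finset.sum_comm]; simpa using hw1
    · intro j _
      dsimp only
      split_ifs with h
      · exact hz ⟨_, rfl⟩
      · exact hs₀
    · have hval : ∀ i, (if h : ∃ i', φ i' = φ i then z h.choose else s₀) = z i := by
        intro i
        have h : ∃ i', φ i' = φ i := ⟨i, rfl⟩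
        rw [dif_pos h, φ.injective h.choose_spec]
      simp only [Finset.sum_smul]
      rw [Finset.sum_comm]
      refine Finset.sum_congr rfl fun i _ => ?_
      rw [Finset.sum_eq_single (φ i)]
      · rw [if_pos rfl, hval]
      · intro j _ hj; rw [if_neg (Ne.symm hj), zero_smul]
      · simp
  · rintro ⟨⟨w, z⟩, ⟨⟨hw0, hw1⟩, hz⟩, rfl⟩
    exact (convex_convexHull ℝ S).sum_mem (fun i _ => hw0 i) hw1
      fun i _ => subset_convexHull ℝ S (hz i trivial)

end

section

variable {V W : Type*} [NormedAddCommGroup V] [InnerProductSpace ℝ V]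
  [NormedAddCommGroup W] [InnerProductSpace ℝ W]

/-- The cone of separable tensors. -/
noncomputable def sepCone (C : Set V) (D : Set W) : PointedCone ℝ (V ⊗[ℝ] W) :=
  PointedCone.hull ℝ {z | ∃ x ∈ C, ∃ y ∈ D, z = x ⊗ₜ[ℝ] y}

/-- The maximal tensor product of two cones consists of separable tensors. -/
def Nuclear (C : Set V) (D : Set W) : Prop :=
  ∀ ω : V ⊗[ℝ] W, (∀ f ∈ dualCone C, ∀ g ∈ dualCone D, 0 ≤ ⟪ω, f ⊗ₜ[ℝ] g⟫) → ω ∈ sepCone C D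

theorem inner_comm_tensor (x y : V ⊗[ℝ] W) : ⟪x, y⟫ = ⟪y, x⟫ := (real_inner_comm x y).symm

theorem inner_smul_left_tensor (c : ℝ) (x y : V ⊗[ℝ] W) : ⟪c • x, y⟫ = c * ⟪x, y⟫ :=
  real_inner_smul_left x y c

theorem inner_smul_right_tensor (c : ℝ) (x y : V ⊗[ℝ] W) : ⟪x, c • y⟫ = c * ⟪x, y⟫ :=
  real_inner_smul_right x y c

theorem inner_add_left_tensor (x y z : V ⊗[ℝ] W) : ⟪x + y, z⟫ = ⟪x, z⟫ + ⟪y, z⟫ :=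
  inner_add_left x y z

theorem inner_zero_left_tensor (x : V ⊗[ℝ] W) : ⟪(0 : V ⊗[ℝ] W), x⟫ = 0 :=
  inner_zero_left x

theorem tmul_mem_sepCone {C : Set V} {D : Set W} {x : V} {y : W} (hx : x ∈ C) (hy : y ∈ D) :
    x ⊗ₜ[ℝ] y ∈ sepCone C D := Submodule.subset_span ⟨x, hx, y, hy, rfl⟩

theorem sepCone_induction {C : Set V} {D : Set W} {P : V ⊗[ℝ] W → Prop}
    (tmul : ∀ x ∈ C, ∀ y ∈ D, P (x ⊗ₜ[ℝ] y)) (zero : P 0) (add : ∀ x y, P x → P y → P (x + y))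
    (smul : ∀ (c : ℝ) x, 0 ≤ c → P x → P (c • x)) {ω : V ⊗[ℝ] W} (hω : ω ∈ sepCone C D) :
    P ω :=
  hull_induction (by rintro _ ⟨x, hx, y, hy, rfl⟩; exact tmul x hx y hy) zero add smul hω

theorem Nuclear.symm {C : Set V} {D : Set W} (h : Nuclear C D) : Nuclear D C := by
  intro ω hω
  have key : ∀ (ω : W ⊗[ℝ] V) (f : V) (g : W),
      ⟪TensorProduct.comm ℝ W V ω, f ⊗ₜ[ℝ] g⟫ = ⟪ω, g ⊗ₜ[ℝ] f⟫ := by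
    intro ω f g
    induction ω with
    | zero => simp
    | tmul x y => simp [mul_comm]
    | add x y hx hy => simp [inner_add_left, hx, hy]
  have h1 := h (TensorProduct.comm ℝ W V ω) fun f hf g hg => by
    rw [key]; exact hω g hg f hf
  have h2 : (TensorProduct.comm ℝ W V).symm (TensorProduct.comm ℝ W V ω) ∈ sepCone D C := by
    refine sepCone_induction (P := fun z => (TensorProduct.comm ℝ W V).symm z ∈ sepCone D C)
      (fun x hx y hy => ?_) ?_ (fun x y hx hy => ?_) (fun c x hc hx => ?_) h1
    · simpa using tmul_mem_sepCone hy hx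
    · simp
    · rw [map_add]; exact add_mem hx hy
    · rw [map_smul]; exact smul_mem_hull hc hx
  simpa using h2

variable [FiniteDimensional ℝ V] [FiniteDimensional ℝ W]

theorem isClosedCone_sepCone {C : Set V} {D : Set W} (hC : IsProperCone C) (hD : IsProperCone D) :
    IsClosedCone (sepCone C D : Set (V ⊗[ℝ] W)) where
  zero_mem := zero_mem _
  add_mem := fun hx hy => add_mem hx hy
  smul_mem := fun ht hx => smul_mem_hull ht hx
  isClosed := by
    obtain ⟨e, he⟩ := hC.exists_pos
    obtain ⟨d, hd⟩ := hD.exists_pos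
    set K : Set (V ⊗[ℝ] W) := convexHull ℝ
      ((fun q : V × W => q.1 ⊗ₜ[ℝ] q.2) '' ({x ∈ C | ⟪e, x⟫ = 1} ×ˢ {y ∈ D | ⟪d, y⟫ = 1})) with hK
    have hcomp : IsCompact K := isCompact_convexHull
      (((isCompact_base hC.toIsClosedCone he).prod (isCompact_base hD.toIsClosedCone hd)).image
        (TensorProduct.continuous_tmul))
    have hone : ∀ z ∈ K, ⟪e ⊗ₜ[ℝ] d, z⟫ = 1 := by
      have hconv : Convex ℝ {z : V ⊗[ℝ] W | ⟪e ⊗ₜ[ℝ] d, z⟫ = 1} :=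
        convex_hyperplane (f := fun z : V ⊗[ℝ] W => ⟪e ⊗ₜ[ℝ] d, z⟫)
          ⟨fun x y => inner_add_right _ _ _, fun c x => by simp [real_inner_smul_right]⟩ 1
      have hsub : K ⊆ {z : V ⊗[ℝ] W | ⟪e ⊗ₜ[ℝ] d, z⟫ = 1} := by
        refine convexHull_min ?_ hconv
        rintro _ ⟨⟨x, y⟩, ⟨⟨-, hx⟩, ⟨-, hy⟩⟩, rfl⟩
        simp_all
      exact hsub
    have hKsep : K ⊆ sepCone C D := by
      refine convexHull_min ?_ ?_
      · rintro _ ⟨⟨x, y⟩, ⟨⟨hx, -⟩, ⟨hy, -⟩⟩, rfl⟩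
        exact tmul_mem_sepCone hx hy
      · intro x hx y hy a b ha hb _
        exact add_mem (smul_mem_hull ha hx) (smul_mem_hull hb hy)
    have hnorm : ∀ x ∈ C, ∀ y ∈ D, x ⊗ₜ[ℝ] y = 0 ∨
        ∃ t : ℝ, 0 ≤ t ∧ ∃ k ∈ K, x ⊗ₜ[ℝ] y = t • k := by
      intro x hx y hy
      by_cases hx0 : x = 0
      · left; simp [hx0]
      by_cases hy0 : y = 0
      · left; simp [hy0]
      right
      have h1 := he x hx hx0
      have h2 := hd y hy hy0
      refine ⟨⟪e, x⟫ * ⟪d, y⟫, by positivity, _,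
        subset_convexHull ℝ _ ⟨(⟪e, x⟫⁻¹ • x, ⟪d, y⟫⁻¹ • y),
        ⟨⟨hC.smul_mem (by positivity) hx, ?_⟩, ⟨hD.smul_mem (by positivity) hy, ?_⟩⟩, rfl⟩, ?_⟩
      · rw [real_inner_smul_right]; field_simp
      · rw [real_inner_smul_right]; field_simp
      · simp only [TensorProduct.smul_tmul', TensorProduct.tmul_smul, smul_smul]
        have : ⟪e, x⟫ * ⟪d, y⟫ * (⟪d, y⟫⁻¹ * ⟪e, x⟫⁻¹) = 1 := by field_simp
        rw [this, one_smul]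
    obtain hemp | ⟨k₀, hk₀⟩ := K.eq_empty_or_nonempty
    · convert isClosed_singleton (X := V ⊗[ℝ] W) (x := 0)
      ext z
      refine ⟨fun hz => ?_, fun hz => hz ▸ zero_mem _⟩
      refine sepCone_induction (P := fun z => z ∈ ({0} : Set (V ⊗[ℝ] W)))
        (fun x hx y hy => ?_) rfl ?_ ?_ hz
      · simpa [hemp] using hnorm x hx y hy
      · rintro _ _ rfl rfl; simp
      · rintro c _ - rfl; simp
    convert isClosed_cone_over hcomp (e ⊗ₜ[ℝ] d) hone
    ext z
    constructor
    · intro hz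
      refine sepCone_induction (P := fun z => ∃ t : ℝ, 0 ≤ t ∧ ∃ k ∈ K, z = t • k)
          ?_ ⟨0, le_rfl, k₀, hk₀, by simp⟩ ?_ ?_ hz
      · intro x hx y hy
        obtain h | h := hnorm x hx y hy
        · exact ⟨0, le_rfl, k₀, hk₀, by simp [h]⟩
        · exact h
      · rintro _ _ ⟨t, ht, k, hk, rfl⟩ ⟨t', ht', k', hk', rfl⟩
        by_cases h0 : t + t' = 0
        · have h1 : t = 0 := by linarith
          have h2 : t' = 0 := by linarith
          exact ⟨0, le_rfl, k₀, hk₀, by simp [h1, h2]⟩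
        · have hpos : 0 < t + t' := lt_of_le_of_ne (by positivity) (Ne.symm h0)
          refine ⟨t + t', by positivity, (t / (t + t')) • k + (t' / (t + t')) • k',
            convex_convexHull ℝ _ hk hk' (by positivity) (by positivity) (by field_simp), ?_⟩
          rw [smul_add, smul_smul, smul_smul, mul_div_cancel₀ _ h0, mul_div_cancel₀ _ h0]
      · rintro c _ hc ⟨t, ht, k, hk, rfl⟩
        exact ⟨c * t, by positivity, k, hk, by rw [smul_smul]⟩
    · rintro ⟨t, ht, k, hk, rfl⟩
      exact smul_mem_hull ht (hKsep hk)

theorem Nuclear.dual {C : Set V} {D : Set W} (hC : IsProperCone C) (hD : IsProperCone D)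
    (h : Nuclear C D) : Nuclear (dualCone C) (dualCone D) := by
  intro ω hω
  rw [hC.dualCone_dualCone, hD.dualCone_dualCone] at hω
  refine (isClosedCone_sepCone hC.dual hD.dual).mem_of_dual fun z hz => ?_
  have hz' : z ∈ sepCone C D := h z fun f hf g hg => hz _ (tmul_mem_sepCone hf hg)
  refine sepCone_induction (P := fun z => 0 ≤ ⟪z, ω⟫) (fun x hx y hy => ?_) (by simp)
    (fun x y hx hy => ?_) (fun c x hc hx => ?_) hz'
  · rw [inner_comm_tensor]; exact hω x hx y hy
  · rw [inner_add_left]; exact add_nonneg hx hy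
  · rw [inner_smul_left_tensor]; exact mul_nonneg hc hx

/-- The exposed face of `C` cut out by `f`, seen in its linear span. -/
def exposedFace (C : Set V) (f : V) : Set (Submodule.span ℝ {x ∈ C | ⟪f, x⟫ = 0}) :=
  {u | (u : V) ∈ C}

omit [FiniteDimensional ℝ V] in
theorem inner_eq_zero_of_mem_span_face {C : Set V} {f x : V}
    (hx : x ∈ Submodule.span ℝ {x ∈ C | ⟪f, x⟫ = 0}) : ⟪f, x⟫ = 0 := by
  have : Submodule.span ℝ {x ∈ C | ⟪f, x⟫ = 0} ≤ LinearMap.ker (innerₗ V f) := by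
    rw [Submodule.span_le]; rintro y ⟨-, hy⟩; simpa using hy
  simpa using this hx

theorem IsProperCone.exposedFace {C : Set V} (hC : IsProperCone C) (f : V) :
    IsProperCone (exposedFace C f) where
  isClosed := hC.isClosed.preimage continuous_subtype_val
  zero_mem := hC.zero_mem
  add_mem := fun hx hy => hC.add_mem hx hy
  smul_mem := fun ht hx => hC.smul_mem ht hx
  span_eq_top := by
    rw [eq_top_iff, ← Submodule.span_span_coe_preimage (R := ℝ) (s := {x ∈ C | ⟪f, x⟫ = 0})]
    exact Submodule.span_mono fun u hu => hu.1
  exists_pos := by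
    obtain ⟨e, he⟩ := hC.exists_pos
    refine ⟨(Submodule.span ℝ {x ∈ C | ⟪f, x⟫ = 0}).orthogonalProjectionOnto e, fun x hx hx0 => ?_⟩
    rw [Submodule.inner_orthogonalProjectionOnto_eq_of_mem_right]
    exact he x hx (by simpa using hx0)

theorem finrank_exposedFace_lt (C : Set V) {f : V} (hf : f ≠ 0) :
    Module.finrank ℝ (Submodule.span ℝ {x ∈ C | ⟪f, x⟫ = 0}) < Module.finrank ℝ V := by
  refine Submodule.finrank_lt fun h => hf ?_
  have := inner_eq_zero_of_mem_span_face (C := C) (f := f) (x := f) (h ▸ Submodule.mem_top)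
  simpa using this

omit [FiniteDimensional ℝ W] in
theorem inner_rTensor_subtype (U : Submodule ℝ V) (ω : U ⊗[ℝ] W) (a : V) (b : W) :
    ⟪U.subtypeₗᵢ.rTensor W ω, a ⊗ₜ[ℝ] b⟫ = ⟪ω, U.orthogonalProjectionOnto a ⊗ₜ[ℝ] b⟫ := by
  induction ω with
  | zero => rw [map_zero, inner_zero_left_tensor, inner_zero_left_tensor]
  | tmul x y =>
    change ⟪(x : V) ⊗ₜ[ℝ] y, a ⊗ₜ[ℝ] b⟫ = _
    rw [TensorProduct.inner_tmul, TensorProduct.inner_tmul,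
      Submodule.inner_orthogonalProjectionOnto_eq_of_mem_left]
  | add x y hx hy => rw [map_add, inner_add_left_tensor, inner_add_left_tensor, hx, hy]

omit [FiniteDimensional ℝ W] in
theorem Nuclear.exposedFace {C : Set V} {D : Set W} (hD : IsProperCone D) (h : Nuclear C D)
    {f : V} (hf : f ∈ dualCone C) : Nuclear (exposedFace C f) D := by
  intro ω hω
  let U := Submodule.span ℝ {x ∈ C | ⟪f, x⟫ = 0}
  let ι := U.subtypeₗᵢ.rTensor W
  have key := fun a b => inner_rTensor_subtype U ω a b
  obtain ⟨d, hd⟩ := hD.exists_pos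
  have hdD : d ∈ dualCone D := fun y hy => by
    by_cases hy0 : y = 0
    · simp [hy0]
    · exact (hd y hy hy0).le
  have h1 : ι ω ∈ sepCone C D := h _ fun a ha b hb => by
    refine (key a b).symm ▸ ?_
    refine hω _ (fun u hu => ?_) b hb
    rw [Submodule.inner_orthogonalProjectionOnto_eq_of_mem_right]
    exact ha _ hu
  have h0 : ⟪ι ω, f ⊗ₜ[ℝ] d⟫ = 0 := by
    have : U.orthogonalProjectionOnto f = 0 := by
      rw [Submodule.orthogonalProjectionOnto_eq_zero_iff, Submodule.mem_orthogonal]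
      intro u hu
      rw [real_inner_comm]
      exact inner_eq_zero_of_mem_span_face hu
    refine (key f d).trans ?_
    rw [this, zero_tmul, inner_comm_tensor, inner_zero_left_tensor]
  have h2 : 0 ≤ ⟪ι ω, f ⊗ₜ[ℝ] d⟫ ∧
      (⟪ι ω, f ⊗ₜ[ℝ] d⟫ = 0 → ∃ z ∈ sepCone (ConeTensor.exposedFace C f) D, ι z = ι ω) := by
    refine sepCone_induction (P := fun w => 0 ≤ ⟪w, f ⊗ₜ[ℝ] d⟫ ∧
      (⟪w, f ⊗ₜ[ℝ] d⟫ = 0 → ∃ z ∈ sepCone (ConeTensor.exposedFace C f) D, ι z = w))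
      (fun x hx y hy => ?_) ?_ (fun x y hx hy => ?_) (fun c x hc hx => ?_) h1
    · rw [TensorProduct.inner_tmul, real_inner_comm, real_inner_comm d y]
      refine ⟨mul_nonneg (hf x hx) (hdD y hy), fun h => ?_⟩
      by_cases hy0 : y = 0
      · exact ⟨0, zero_mem _, by simp [hy0]⟩
      have hx0 : ⟪f, x⟫ = 0 := (mul_eq_zero.1 h).resolve_right (hd y hy hy0).ne'
      exact ⟨(⟨x, Submodule.subset_span ⟨hx, hx0⟩⟩ : U) ⊗ₜ[ℝ] y,
        tmul_mem_sepCone (by exact hx) hy, by simp [ι]⟩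
    · exact ⟨(inner_zero_left_tensor _).ge, fun _ => ⟨0, zero_mem _, map_zero _⟩⟩
    · rw [inner_add_left_tensor]
      refine ⟨add_nonneg hx.1 hy.1, fun h => ?_⟩
      obtain ⟨z, hz, hz'⟩ := hx.2 (by linarith [hx.1, hy.1])
      obtain ⟨w, hw, hw'⟩ := hy.2 (by linarith [hx.1, hy.1])
      exact ⟨z + w, add_mem hz hw, by rw [map_add, hz', hw']⟩
    · rw [inner_smul_left_tensor]
      refine ⟨mul_nonneg hc hx.1, fun h => ?_⟩
      obtain rfl | h := mul_eq_zero.1 h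
      · exact ⟨0, zero_mem _, by simp⟩
      · obtain ⟨z, hz, hz'⟩ := hx.2 h
        exact ⟨c • z, smul_mem_hull hc hz, by rw [map_smul, hz']⟩
  obtain ⟨z, hz, hz'⟩ := h2.2 h0
  exact ι.injective hz' ▸ hz

end

section

variable {V : Type*} [NormedAddCommGroup V] [InnerProductSpace ℝ V]

/-- The cone generated by a finite linearly independent family. -/
def IsSimplicial (C : Set V) : Prop :=
  ∃ (n : ℕ) (b : Fin n → V), LinearIndependent ℝ b ∧
    C = {v | ∃ c : Fin n → ℝ, (∀ i, 0 ≤ c i) ∧ v = ∑ i, c i • b i}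

theorem linearIndependent_of_biorthogonal {ι : Type*} [DecidableEq ι] {b l : ι → V}
    (h : ∀ i j, ⟪l i, b j⟫ = if i = j then 1 else 0) : LinearIndependent ℝ b := by
  rw [linearIndependent_iff']
  intro s g hg i hi
  have := congrArg (fun v => ⟪l i, v⟫) hg
  simpa [inner_sum, real_inner_smul_right, h, hi] using this

theorem inner_sum_biorthogonal {ι : Type*} [Fintype ι] [DecidableEq ι] {b l : ι → V}
    (h : ∀ i j, ⟪l i, b j⟫ = if i = j then 1 else 0) (c : ι → ℝ) (i : ι) :
    ⟪l i, ∑ j, c j • b j⟫ = c i := by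
  simp [inner_sum, real_inner_smul_right, h]

variable [FiniteDimensional ℝ V]

theorem exists_inner_eq (L : V →ₗ[ℝ] ℝ) : ∃ l : V, ∀ x, ⟪l, x⟫ = L x :=
  ⟨(InnerProductSpace.toDual ℝ V).symm L.toContinuousLinearMap, fun x => by simp⟩

theorem exists_biorthogonal {ι : Type*} [DecidableEq ι] {b : ι → V}
    (hb : LinearIndependent ℝ b) : ∃ l : ι → V, ∀ i j, ⟪l i, b j⟫ = if i = j then 1 else 0 := by
  have : ∀ i, ∃ l : V, ∀ j, ⟪l, b j⟫ = if i = j then 1 else 0 := by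
    intro i
    obtain ⟨L, hL⟩ := ((Module.Basis.span hb).coord i).exists_extend
    obtain ⟨l, hl⟩ := exists_inner_eq L
    refine ⟨l, fun j => ?_⟩
    have h1 := LinearMap.congr_fun hL (Module.Basis.span hb j)
    rw [LinearMap.comp_apply, Submodule.subtype_apply, Module.Basis.span_apply] at h1
    rw [hl, h1]
    simp [Finsupp.single_apply, eq_comm]
  choose l hl using this
  exact ⟨l, hl⟩

/-- A linearly independent family in a closed cone which detects positivity of functionals
generates the cone. -/
theorem isSimplicial_of_forall_dual {ι : Type*} [Fintype ι] {b : ι → V} {C : Set V}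
    (hC : IsClosedCone C) (hb : LinearIndependent ℝ b) (hbC : ∀ i, b i ∈ C)
    (h : ∀ g, (∀ i, 0 ≤ ⟪g, b i⟫) → g ∈ dualCone C) : IsSimplicial C := by
  classical
  let e := Fintype.equivFin ι
  obtain ⟨l, hl⟩ := exists_biorthogonal hb
  refine ⟨_, b ∘ e.symm, hb.comp _ e.symm.injective, Set.Subset.antisymm (fun y hy => ?_) ?_⟩
  · have hpos : ∀ i, 0 ≤ ⟪l i, y⟫ := fun i =>
      h (l i) (fun j => by rw [hl]; split_ifs <;> norm_num) y hy
    refine ⟨fun i => ⟪l (e.symm i), y⟫, fun i => hpos _, ext_inner_left ℝ fun v => ?_⟩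
    have hz : ∀ j, ⟪v - ∑ i, ⟪v, b i⟫ • l i, b j⟫ = 0 := by
      intro j
      simp [inner_sub_left, sum_inner, real_inner_smul_left, hl]
    have h1 := h _ (fun j => (hz j).ge) y hy
    have h2 := h (-(v - ∑ i, ⟪v, b i⟫ • l i)) (fun j => by rw [inner_neg_left, hz, neg_zero]) y hy
    rw [inner_neg_left] at h2
    have h3 : ⟪v - ∑ i, ⟪v, b i⟫ • l i, y⟫ = 0 := by linarith
    rw [inner_sub_left, sub_eq_zero, sum_inner] at h3
    rw [h3, inner_sum, Fintype.sum_equiv e]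
    intro i
    simp [real_inner_smul_left, real_inner_smul_right, mul_comm]
  · rintro _ ⟨c, hc, rfl⟩
    refine Finset.sum_induction _ (· ∈ C) (fun _ _ => hC.add_mem) hC.zero_mem fun i _ =>
      hC.smul_mem (hc i) (hbC _)

theorem IsSimplicial.of_dualCone {C : Set V} (hC : IsProperCone C)
    (h : IsSimplicial (dualCone C)) : IsSimplicial C := by
  obtain ⟨n, b, hb, hbC⟩ := h
  obtain ⟨l, hl⟩ := exists_biorthogonal hb
  have hl' : ∀ i j, ⟪b i, l j⟫ = if i = j then 1 else 0 := fun i j => by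
    rw [real_inner_comm, hl]; simp [eq_comm]
  refine isSimplicial_of_forall_dual hC.toIsClosedCone (linearIndependent_of_biorthogonal hl')
    (fun i => hC.mem_of_dual fun f hf => ?_) fun g hg => ?_
  · rw [hbC] at hf
    obtain ⟨c, hc, rfl⟩ := hf
    rw [real_inner_comm, inner_sum_biorthogonal hl]
    exact hc i
  · have hspan : g ∈ Submodule.span ℝ (Set.range b) := by
      have : Submodule.span ℝ (dualCone C) ≤ Submodule.span ℝ (Set.range b) := by
        rw [Submodule.span_le, hbC]
        rintro _ ⟨c, -, rfl⟩
        exact Submodule.sum_mem _ fun i _ => Submodule.smul_mem _ _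
          (Submodule.subset_span ⟨i, rfl⟩)
      exact this (hC.dual.span_eq_top ▸ Submodule.mem_top)
    obtain ⟨c, rfl⟩ := (Submodule.mem_span_range_iff_exists_fun ℝ).1 hspan
    rw [hbC]
    refine ⟨c, fun i => ?_, rfl⟩
    have := hg i
    rwa [real_inner_comm, inner_sum_biorthogonal hl] at this

end

section

theorem exists_linear_relation_of_cross_eq_zero {u₁ u₂ u₃ v₁ v₂ v₃ : ℝ} (h₁₂ : u₁ * v₂ = u₂ * v₁)
    (h₂₃ : u₂ * v₃ = u₃ * v₂) (h₁₃ : u₁ * v₃ = u₃ * v₁) :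
    ∃ a b : ℝ, ¬ (a = 0 ∧ b = 0) ∧ a * u₁ + b * v₁ = 0 ∧ a * u₂ + b * v₂ = 0 ∧
      a * u₃ + b * v₃ = 0 := by
  by_cases h₁ : v₁ = 0
  · by_cases h₂ : v₂ = 0
    · by_cases h₃ : v₃ = 0
      · exact ⟨0, 1, by simp, by simp [h₁], by simp [h₂], by simp [h₃]⟩
      · exact ⟨v₃, -u₃, by simp [h₃], by linarith, by linarith, by ring⟩
    · exact ⟨v₂, -u₂, by simp [h₂], by linarith, by ring, by linarith⟩
  · exact ⟨v₁, -u₁, by simp [h₁], by ring, by linarith, by linarith⟩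

theorem cross_eq_zero_of_orthogonal {u₁ u₂ u₃ v₁ v₂ v₃ w₁ w₂ w₃ x₁ x₂ x₃ : ℝ}
    (h : ¬ (u₁ * v₂ = u₂ * v₁ ∧ u₂ * v₃ = u₃ * v₂ ∧ u₁ * v₃ = u₃ * v₁))
    (huw : u₁ * w₁ + u₂ * w₂ + u₃ * w₃ = 0) (hvw : v₁ * w₁ + v₂ * w₂ + v₃ * w₃ = 0)
    (hux : u₁ * x₁ + u₂ * x₂ + u₃ * x₃ = 0) (hvx : v₁ * x₁ + v₂ * x₂ + v₃ * x₃ = 0) :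
    w₁ * x₂ = w₂ * x₁ ∧ w₂ * x₃ = w₃ * x₂ ∧ w₁ * x₃ = w₃ * x₁ := by
  obtain ⟨n₁, hn₁⟩ : ∃ n, n = u₂ * v₃ - u₃ * v₂ := ⟨_, rfl⟩
  obtain ⟨n₂, hn₂⟩ : ∃ n, n = u₃ * v₁ - u₁ * v₃ := ⟨_, rfl⟩
  obtain ⟨n₃, hn₃⟩ : ∃ n, n = u₁ * v₂ - u₂ * v₁ := ⟨_, rfl⟩
  have hw₁₂ : n₁ * w₂ = n₂ * w₁ := by
    rw [hn₁, hn₂]; linear_combination (-u₃) * hvw + v₃ * huw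
  have hw₂₃ : n₂ * w₃ = n₃ * w₂ := by
    rw [hn₂, hn₃]; linear_combination (-u₁) * hvw + v₁ * huw
  have hw₁₃ : n₁ * w₃ = n₃ * w₁ := by
    rw [hn₁, hn₃]; linear_combination (u₂) * hvw - v₂ * huw
  have hx₁₂ : n₁ * x₂ = n₂ * x₁ := by
    rw [hn₁, hn₂]; linear_combination (-u₃) * hvx + v₃ * hux
  have hx₂₃ : n₂ * x₃ = n₃ * x₂ := by
    rw [hn₂, hn₃]; linear_combination (-u₁) * hvx + v₁ * hux
  have hx₁₃ : n₁ * x₃ = n₃ * x₁ := by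
    rw [hn₁, hn₃]; linear_combination (u₂) * hvx - v₂ * hux
  by_cases h₁ : n₁ = 0
  · by_cases h₂ : n₂ = 0
    · by_cases h₃ : n₃ = 0
      · exact absurd ⟨by linarith, by linarith, by linarith⟩ h
      · refine ⟨mul_left_cancel₀ h₃ ?_, mul_left_cancel₀ h₃ ?_, mul_left_cancel₀ h₃ ?_⟩
        · linear_combination (-x₂) * hw₁₃ + x₁ * hw₂₃ + w₃ * hx₁₂
        · linear_combination w₃ * hx₂₃ - x₃ * hw₂₃
        · linear_combination w₃ * hx₁₃ - x₃ * hw₁₃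
    · refine ⟨mul_left_cancel₀ h₂ ?_, mul_left_cancel₀ h₂ ?_, mul_left_cancel₀ h₂ ?_⟩
      · linear_combination w₂ * hx₁₂ - x₂ * hw₁₂
      · linear_combination w₂ * hx₂₃ - x₂ * hw₂₃
      · linear_combination (-x₃) * hw₁₂ + x₁ * (-hw₂₃) + w₂ * hx₁₃
  · refine ⟨mul_left_cancel₀ h₁ ?_, mul_left_cancel₀ h₁ ?_, mul_left_cancel₀ h₁ ?_⟩
    · linear_combination w₁ * hx₁₂ - x₁ * hw₁₂
    · linear_combination x₃ * hw₁₂ - x₂ * hw₁₃ + w₁ * hx₂₃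
    · linear_combination w₁ * hx₁₃ - x₁ * hw₁₃

variable {V W : Type*} [NormedAddCommGroup V] [InnerProductSpace ℝ V]
  [NormedAddCommGroup W] [InnerProductSpace ℝ W]

/-- Two pairs of functionals with the same sum sandwiching a two-dimensional quotient of the cone
between squares. -/
structure Sandwich (C : Set V) where
  (z₁ z₂ z₃ z₄ f₁ f₂ f₃ f₄ φ χ : V)
  z₁_mem : z₁ ∈ C
  z₂_mem : z₂ ∈ C
  z₃_mem : z₃ ∈ C
  z₄_mem : z₄ ∈ C
  f₁_mem : f₁ ∈ dualCone C
  f₂_mem : f₂ ∈ dualCone C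
  f₃_mem : f₃ ∈ dualCone C
  f₄_mem : f₄ ∈ dualCone C
  z_add : z₁ + z₃ = z₂ + z₄
  f_add : f₁ + f₃ = f₂ + f₄
  inner₁ : ⟪f₁, z₁⟫ = 0
  inner₂ : ⟪f₂, z₂⟫ = 0
  inner₃ : ⟪f₃, z₃⟫ = 0
  inner₄ : ⟪f₄, z₄⟫ = 0
  corner : ∀ x ∈ C, (⟪f₁, x⟫ = 0 ∨ ⟪f₃, x⟫ = 0) → (⟪f₂, x⟫ = 0 ∨ ⟪f₄, x⟫ = 0) →
    ⟪φ, x⟫ = 0 ∧ ⟪χ, x⟫ = 0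
  indep : ∀ a b : ℝ, a * ⟪φ, z₁⟫ + b * ⟪χ, z₁⟫ = 0 → a * ⟪φ, z₂⟫ + b * ⟪χ, z₂⟫ = 0 →
    a * ⟪φ, z₃⟫ + b * ⟪χ, z₃⟫ = 0 → a = 0 ∧ b = 0

namespace Sandwich

/-- The sandwich with the two pairs exchanged. -/
def swap {C : Set V} (S : Sandwich C) : Sandwich C where
  z₁ := S.z₂
  z₂ := S.z₁
  z₃ := S.z₄
  z₄ := S.z₃
  f₁ := S.f₂
  f₂ := S.f₁
  f₃ := S.f₄
  f₄ := S.f₃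
  φ := S.φ
  χ := S.χ
  z₁_mem := S.z₂_mem
  z₂_mem := S.z₁_mem
  z₃_mem := S.z₄_mem
  z₄_mem := S.z₃_mem
  f₁_mem := S.f₂_mem
  f₂_mem := S.f₁_mem
  f₃_mem := S.f₄_mem
  f₄_mem := S.f₃_mem
  z_add := S.z_add.symm
  f_add := S.f_add.symm
  inner₁ := S.inner₂
  inner₂ := S.inner₁
  inner₃ := S.inner₄
  inner₄ := S.inner₃
  corner := fun x hx h h' => S.corner x hx h' h
  indep := fun a b h₂ h₁ h₄ => S.indep a b h₁ h₂ (by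
    have : S.z₃ = S.z₂ + S.z₄ - S.z₁ := by rw [← S.z_add]; abel
    rw [this, inner_sub_right, inner_add_right, inner_sub_right, inner_add_right]
    linarith)

variable {C : Set V} {D : Set W}

/-- The tensor built from two sandwiches which lies in the maximal tensor product. -/
noncomputable def tensor (S : Sandwich C) (T : Sandwich D) : V ⊗[ℝ] W :=
  S.z₃ ⊗ₜ T.z₃ + S.z₁ ⊗ₜ T.z₂ + S.z₂ ⊗ₜ T.z₁ - S.z₂ ⊗ₜ T.z₂

/-- The witness built from two sandwiches which is nonnegative on separable tensors. -/
noncomputable def witness (S : Sandwich C) (T : Sandwich D) : V ⊗[ℝ] W :=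
  S.f₃ ⊗ₜ T.f₁ + S.f₁ ⊗ₜ T.f₄ + S.f₂ ⊗ₜ T.f₃ - S.f₂ ⊗ₜ T.f₄

theorem inner_tensor (S : Sandwich C) (T : Sandwich D) (f : V) (g : W) :
    ⟪f ⊗ₜ[ℝ] g, S.tensor T⟫ = ⟪f, S.z₃⟫ * ⟪g, T.z₃⟫ + ⟪f, S.z₁⟫ * ⟪g, T.z₂⟫ +
      ⟪f, S.z₂⟫ * ⟪g, T.z₁⟫ - ⟪f, S.z₂⟫ * ⟪g, T.z₂⟫ := by
  simp [tensor, inner_add_right, inner_sub_right]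

theorem inner_witness (S : Sandwich C) (T : Sandwich D) (x : V) (y : W) :
    ⟪S.witness T, x ⊗ₜ[ℝ] y⟫ = ⟪S.f₃, x⟫ * ⟪T.f₁, y⟫ + ⟪S.f₁, x⟫ * ⟪T.f₄, y⟫ +
      ⟪S.f₂, x⟫ * ⟪T.f₃, y⟫ - ⟪S.f₂, x⟫ * ⟪T.f₄, y⟫ := by
  simp [witness, inner_add_left, inner_sub_left]

theorem inner_tensor_nonneg (S : Sandwich C) (T : Sandwich D) {f : V} {g : W}
    (hf : f ∈ dualCone C) (hg : g ∈ dualCone D) : 0 ≤ ⟪f ⊗ₜ[ℝ] g, S.tensor T⟫ := by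
  rw [inner_tensor]
  have hS := congrArg (fun v => ⟪f, v⟫) S.z_add
  have hT := congrArg (fun v => ⟪g, v⟫) T.z_add
  simp only [inner_add_right] at hS hT
  have h1 := hf _ S.z₁_mem
  have h2 := hf _ S.z₂_mem
  have h3 := hf _ S.z₃_mem
  have h4 := hf _ S.z₄_mem
  have h1' := hg _ T.z₁_mem
  have h2' := hg _ T.z₂_mem
  have h3' := hg _ T.z₃_mem
  have h4' := hg _ T.z₄_mem
  obtain h | h := le_total ⟪g, T.z₂⟫ ⟪g, T.z₁⟫
  · nlinarith [mul_nonneg h3 h3', mul_nonneg h1 h2', mul_nonneg h2 (sub_nonneg.2 h)]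
  · nlinarith [mul_nonneg h3 h4', mul_nonneg h1 h1', mul_nonneg h4 (sub_nonneg.2 h)]

theorem inner_witness_tmul_nonneg (S : Sandwich C) (T : Sandwich D) {x : V} {y : W} (hx : x ∈ C)
    (hy : y ∈ D) : 0 ≤ ⟪S.witness T, x ⊗ₜ[ℝ] y⟫ ∧ (⟪S.witness T, x ⊗ₜ[ℝ] y⟫ = 0 →
      (⟪S.φ, x⟫ = 0 ∧ ⟪S.χ, x⟫ = 0) ∨ (⟪T.φ, y⟫ = 0 ∧ ⟪T.χ, y⟫ = 0)) := by
  rw [inner_witness]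
  have hS := congrArg (fun v => ⟪v, x⟫) S.f_add
  have hT := congrArg (fun v => ⟪v, y⟫) T.f_add
  have hcS := S.corner x hx
  have hcT := T.corner y hy
  simp only [inner_add_left] at hS hT
  have h1 := S.f₁_mem x hx
  have h2 := S.f₂_mem x hx
  have h3 := S.f₃_mem x hx
  have h4 := S.f₄_mem x hx
  have h1' := T.f₁_mem y hy
  have h2' := T.f₂_mem y hy
  have h3' := T.f₃_mem y hy
  have h4' := T.f₄_mem y hy
  generalize ⟪S.f₁, x⟫ = a₁ at *
  generalize ⟪S.f₂, x⟫ = a₂ at *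
  generalize ⟪S.f₃, x⟫ = a₃ at *
  generalize ⟪S.f₄, x⟫ = a₄ at *
  generalize ⟪T.f₁, y⟫ = b₁ at *
  generalize ⟪T.f₂, y⟫ = b₂ at *
  generalize ⟪T.f₃, y⟫ = b₃ at *
  generalize ⟪T.f₄, y⟫ = b₄ at *
  obtain h | h := le_total b₄ b₃
  · have e : a₃ * b₁ + a₁ * b₄ + a₂ * b₃ - a₂ * b₄ = a₃ * b₁ + a₁ * b₄ + a₂ * (b₃ - b₄) := by ring
    have p1 := mul_nonneg h3 h1'
    have p2 := mul_nonneg h1 h4'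
    have p3 := mul_nonneg h2 (sub_nonneg.2 h)
    refine ⟨by linarith, fun h0 => ?_⟩
    have q1 : a₃ * b₁ = 0 := by linarith
    have q2 : a₁ * b₄ = 0 := by linarith
    have q3 : a₂ * (b₃ - b₄) = 0 := by linarith
    rw [mul_eq_zero] at q1 q2 q3
    grind
  · have e : a₃ * b₁ + a₁ * b₄ + a₂ * b₃ - a₂ * b₄ = a₃ * b₂ + a₁ * b₃ + a₄ * (b₄ - b₃) := by
      linear_combination a₃ * hT + (b₄ - b₃) * hS
    have p1 := mul_nonneg h3 h2'
    have p2 := mul_nonneg h1 h3'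
    have p3 := mul_nonneg h4 (sub_nonneg.2 h)
    refine ⟨by linarith, fun h0 => ?_⟩
    have q1 : a₃ * b₂ = 0 := by linarith
    have q2 : a₁ * b₃ = 0 := by linarith
    have q3 : a₄ * (b₄ - b₃) = 0 := by linarith
    rw [mul_eq_zero] at q1 q2 q3
    grind

theorem inner_witness_tensor_add_swap (S : Sandwich C) (T : Sandwich D) :
    ⟪S.witness T, S.tensor T⟫ + ⟪S.witness T.swap, S.tensor T.swap⟫ = 0 := by
  have hf : S.f₄ = S.f₁ + S.f₃ - S.f₂ := eq_sub_of_add_eq' S.f_add.symm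
  have hz : S.z₄ = S.z₁ + S.z₃ - S.z₂ := eq_sub_of_add_eq' S.z_add.symm
  have hf' : T.f₄ = T.f₁ + T.f₃ - T.f₂ := eq_sub_of_add_eq' T.f_add.symm
  have hz' : T.z₄ = T.z₁ + T.z₃ - T.z₂ := eq_sub_of_add_eq' T.z_add.symm
  have h := S.inner₄
  have h' := T.inner₄
  rw [hf, hz] at h
  rw [hf', hz'] at h'
  simp only [inner_add_left, inner_add_right, inner_sub_left, inner_sub_right, S.inner₁, S.inner₂,
    S.inner₃, T.inner₁, T.inner₂, T.inner₃] at h h'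
  have e : ⟪S.f₁, S.z₃⟫ = ⟪S.f₁, S.z₂⟫ - ⟪S.f₃, S.z₁⟫ + ⟪S.f₃, S.z₂⟫ + ⟪S.f₂, S.z₁⟫ +
      ⟪S.f₂, S.z₃⟫ := by linarith
  have e' : ⟪T.f₁, T.z₃⟫ = ⟪T.f₁, T.z₂⟫ - ⟪T.f₃, T.z₁⟫ + ⟪T.f₃, T.z₂⟫ + ⟪T.f₂, T.z₁⟫ +
      ⟪T.f₂, T.z₃⟫ := by linarith
  simp only [witness, tensor, swap, hf', hz', TensorProduct.inner_tmul, inner_add_left,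
    inner_add_right, inner_sub_left, inner_sub_right, S.inner₁, S.inner₂,
    S.inner₃, T.inner₁, T.inner₂, T.inner₃, e, e']
  ring

theorem false_of_nonpos (S : Sandwich C) (T : Sandwich D) (h : Nuclear C D)
    (hST : ⟪S.witness T, S.tensor T⟫ ≤ 0) : False := by
  have hsep : S.tensor T ∈ sepCone C D := h _ fun f hf g hg => by
    rw [inner_comm_tensor]; exact S.inner_tensor_nonneg T hf hg
  have key := sepCone_induction (P := fun w => 0 ≤ ⟪S.witness T, w⟫ ∧
    (⟪S.witness T, w⟫ = 0 → ⟪S.φ ⊗ₜ[ℝ] T.φ, w⟫ = 0 ∧ ⟪S.φ ⊗ₜ[ℝ] T.χ, w⟫ = 0 ∧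
      ⟪S.χ ⊗ₜ[ℝ] T.φ, w⟫ = 0 ∧ ⟪S.χ ⊗ₜ[ℝ] T.χ, w⟫ = 0))
    (fun x hx y hy => ?_) ?_ (fun x y hx hy => ?_) (fun c x hc hx => ?_) hsep
  · obtain ⟨h1, h2, h3, h4⟩ := key.2 (le_antisymm hST key.1)
    rw [inner_tensor] at h1 h2 h3 h4
    by_cases hcr : ⟪S.φ, S.z₁⟫ * ⟪S.χ, S.z₂⟫ = ⟪S.φ, S.z₂⟫ * ⟪S.χ, S.z₁⟫ ∧
        ⟪S.φ, S.z₂⟫ * ⟪S.χ, S.z₃⟫ = ⟪S.φ, S.z₃⟫ * ⟪S.χ, S.z₂⟫ ∧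
        ⟪S.φ, S.z₁⟫ * ⟪S.χ, S.z₃⟫ = ⟪S.φ, S.z₃⟫ * ⟪S.χ, S.z₁⟫
    · obtain ⟨a, b, hab, e1, e2, e3⟩ :=
        exists_linear_relation_of_cross_eq_zero hcr.1 hcr.2.1 hcr.2.2
      exact hab (S.indep a b e1 e2 e3)
    · obtain ⟨c1, c2, c3⟩ := cross_eq_zero_of_orthogonal hcr
        (w₁ := ⟪T.φ, T.z₂⟫) (w₂ := ⟪T.φ, T.z₁⟫ - ⟪T.φ, T.z₂⟫) (w₃ := ⟪T.φ, T.z₃⟫)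
        (x₁ := ⟪T.χ, T.z₂⟫) (x₂ := ⟪T.χ, T.z₁⟫ - ⟪T.χ, T.z₂⟫) (x₃ := ⟪T.χ, T.z₃⟫)
        (by linarith) (by linarith) (by linarith) (by linarith)
      obtain ⟨a, b, hab, e1, e2, e3⟩ := exists_linear_relation_of_cross_eq_zero c1 c2 c3
      exact hab (T.indep a b (by linarith) (by linarith) (by linarith))
  · obtain ⟨h1, h2⟩ := S.inner_witness_tmul_nonneg T hx hy
    refine ⟨h1, fun h0 => ?_⟩
    simp only [TensorProduct.inner_tmul]
    obtain ⟨e1, e2⟩ | ⟨e1, e2⟩ := h2 h0 <;> simp [e1, e2]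
  · simp
  · simp only [inner_add_right]
    refine ⟨add_nonneg hx.1 hy.1, fun h0 => ?_⟩
    obtain ⟨a1, a2, a3, a4⟩ := hx.2 (by linarith [hx.1, hy.1])
    obtain ⟨b1, b2, b3, b4⟩ := hy.2 (by linarith [hx.1, hy.1])
    simp [a1, a2, a3, a4, b1, b2, b3, b4]
  · simp only [inner_smul_right_tensor]
    refine ⟨mul_nonneg hc hx.1, fun h0 => ?_⟩
    obtain rfl | h0 := mul_eq_zero.1 h0
    · simp
    · obtain ⟨a1, a2, a3, a4⟩ := hx.2 h0
      simp [a1, a2, a3, a4]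

theorem not_nuclear (S : Sandwich C) (T : Sandwich D) : ¬ Nuclear C D := fun h => by
  obtain h' | h' := le_total ⟪S.witness T, S.tensor T⟫ 0
  · exact S.false_of_nonpos T h h'
  · exact S.false_of_nonpos T.swap h (by linarith [S.inner_witness_tensor_add_swap T])

end Sandwich

end

section

variable {V : Type*} [NormedAddCommGroup V] [InnerProductSpace ℝ V]

/-- `x` spans an exposed ray of `C`. -/
structure ExposedRay (C : Set V) (x : V) : Prop where
  mem : x ∈ C
  ne_zero : x ≠ 0
  exists_dual : ∃ f ∈ dualCone C, ⟪f, x⟫ = 0 ∧ ∀ y ∈ C, ⟪f, y⟫ = 0 → ∃ t : ℝ, 0 ≤ t ∧ y = t • x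

theorem exposedRay_of_farthest {C : Set V} (hC : IsClosedCone C) {e : V}
    (he : ∀ x ∈ C, x ≠ 0 → 0 < ⟪e, x⟫) {c m : V} (hm : m ∈ C) (hem : ⟪e, m⟫ = 1)
    (hmax : ∀ y ∈ C, ⟪e, y⟫ = 1 → ‖y - c‖ ≤ ‖m - c‖) : ExposedRay C m where
  mem := hm
  ne_zero := by rintro rfl; simp at hem
  exists_dual := by
    have key : ∀ y ∈ C, ⟪e, y⟫ = 1 → ‖m - y‖ ^ 2 / 2 ≤ ⟪⟪m - c, m⟫ • e - (m - c), y⟫ := by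
      intro y hy hey
      have h1 := pow_le_pow_left₀ (norm_nonneg _) (hmax y hy hey) 2
      have h2 : y - c = (m - c) - (m - y) := by abel
      rw [h2, norm_sub_sq_real] at h1
      rw [inner_sub_left ((⟪m - c, m⟫) • e), real_inner_smul_left, hey]
      rw [inner_sub_right (m - c) m y] at h1
      linarith
    have scale : ∀ y ∈ C, y ≠ 0 → (⟪e, y⟫⁻¹ • y) ∈ C ∧ ⟪e, ⟪e, y⟫⁻¹ • y⟫ = 1 := by
      intro y hy hy0
      have := he y hy hy0
      exact ⟨hC.smul_mem (by positivity) hy, by rw [real_inner_smul_right]; field_simp⟩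
    refine ⟨⟪m - c, m⟫ • e - (m - c), fun y hy => ?_, ?_, fun y hy h0 => ?_⟩
    · by_cases hy0 : y = 0
      · simp [hy0]
      obtain ⟨h1, h2⟩ := scale y hy hy0
      have h3 := key _ h1 h2
      rw [real_inner_smul_right] at h3
      have h4 : 0 ≤ ‖m - ⟪e, y⟫⁻¹ • y‖ ^ 2 / 2 := by positivity
      exact nonneg_of_mul_nonneg_right (h4.trans h3) (inv_pos.2 (he y hy hy0))
    · rw [inner_sub_left ((⟪m - c, m⟫) • e), real_inner_smul_left, hem]; ring
    · by_cases hy0 : y = 0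
      · exact ⟨0, le_rfl, by simp [hy0]⟩
      obtain ⟨h1, h2⟩ := scale y hy hy0
      have h3 := key _ h1 h2
      rw [real_inner_smul_right, h0, mul_zero] at h3
      have h4 : ‖m - ⟪e, y⟫⁻¹ • y‖ = 0 := by nlinarith [norm_nonneg (m - ⟪e, y⟫⁻¹ • y)]
      have h5 := he y hy hy0
      refine ⟨⟪e, y⟫, h5.le, ?_⟩
      rw [sub_eq_zero.1 (norm_eq_zero.1 h4), smul_smul, mul_inv_cancel₀ h5.ne', one_smul]

/-- Straszewicz's theorem, in dual form. -/
theorem mem_dualCone_of_exposedRay [FiniteDimensional ℝ V] {C : Set V} (hC : IsClosedCone C)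
    {e : V} (he : ∀ x ∈ C, x ≠ 0 → 0 < ⟪e, x⟫) {g : V}
    (h : ∀ v, ExposedRay C v → ⟪e, v⟫ = 1 → 0 ≤ ⟪g, v⟫) : g ∈ dualCone C := by
  intro z hz
  by_contra! hgz
  have hz0 : z ≠ 0 := by rintro rfl; simp at hgz
  have hez := he z hz hz0
  have hK := isCompact_base hC he
  obtain ⟨B, hB⟩ := hK.isBounded.exists_norm_le
  set z' := ⟪e, z⟫⁻¹ • z with hz'
  have hz'K : z' ∈ {x ∈ C | ⟪e, x⟫ = 1} :=
    ⟨hC.smul_mem (by positivity) hz, by rw [hz', real_inner_smul_right]; field_simp⟩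
  have hgz' : ⟪g, z'⟫ < 0 := by
    rw [hz', real_inner_smul_right]; exact mul_neg_of_pos_of_neg (by positivity) hgz
  set R := (B ^ 2 + 1) / (-2 * ⟪g, z'⟫) with hR
  have hRpos : 0 < R := div_pos (by positivity) (by linarith)
  have hRz : 2 * R * ⟪g, z'⟫ = -(B ^ 2 + 1) := by
    have := hgz'.ne
    rw [hR]; field_simp
  obtain ⟨m, ⟨hmC, hem⟩, hmax⟩ := hK.exists_isMaxOn ⟨z', hz'K⟩
    (f := fun y => ‖y - R • g‖) (by fun_prop)
  have hmax_le : ∀ y ∈ C, ⟪e, y⟫ = 1 → ‖y - R • g‖ ≤ ‖m - R • g‖ := fun y hy hey =>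
    hmax ⟨hy, hey⟩
  have hgm := h m (exposedRay_of_farthest hC he hmC hem hmax_le) hem
  have h1 := pow_le_pow_left₀ (norm_nonneg _) (hmax_le z' hz'K.1 hz'K.2) 2
  rw [norm_sub_sq_real, norm_sub_sq_real, real_inner_smul_right, real_inner_smul_right,
    real_inner_comm, real_inner_comm g m] at h1
  have h2 := pow_le_pow_left₀ (norm_nonneg _) (hB m ⟨hmC, hem⟩) 2
  nlinarith [sq_nonneg ‖z'‖, mul_nonneg hRpos.le hgm]

end

section

variable {V : Type*} [NormedAddCommGroup V] [InnerProductSpace ℝ V]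

theorem ExposedRay.exists_eq_smul {C : Set V} {x e : V} (h : ExposedRay C x) (hx : ⟪e, x⟫ = 1) :
    ∃ f ∈ dualCone C, ⟪f, x⟫ = 0 ∧ ∀ y ∈ C, ⟪f, y⟫ = 0 → y = ⟪e, y⟫ • x := by
  obtain ⟨f, hf, hfx, h⟩ := h.exists_dual
  refine ⟨f, hf, hfx, fun y hy h0 => ?_⟩
  obtain ⟨t, -, rfl⟩ := h y hy h0
  rw [real_inner_smul_right, hx, mul_one]

theorem pos_of_forall_eq_smul {C : Set V} {x y e f : V} (hf : f ∈ dualCone C)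
    (h : ∀ y ∈ C, ⟪f, y⟫ = 0 → y = ⟪e, y⟫ • x) (hy : y ∈ C) (hey : ⟪e, y⟫ = 1) (hxy : y ≠ x) :
    0 < ⟪f, y⟫ :=
  lt_of_le_of_ne (hf y hy) fun h0 => hxy (by rw [h y hy h0.symm, hey, one_smul])

theorem ExposedRay.exists_normalized {C : Set V} {x y e : V} (h : ExposedRay C x)
    (hx : ⟪e, x⟫ = 1) (hy : y ∈ C) (hey : ⟪e, y⟫ = 1) (hxy : y ≠ x) :
    ∃ f ∈ dualCone C, ⟪f, x⟫ = 0 ∧ ⟪f, y⟫ = 1 ∧ ∀ y ∈ C, ⟪f, y⟫ = 0 → y = ⟪e, y⟫ • x := by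
  obtain ⟨f, hf, hfx, h⟩ := h.exists_eq_smul hx
  have hpos := pos_of_forall_eq_smul hf h hy hey hxy
  refine ⟨⟪f, y⟫⁻¹ • f, (isClosedCone_dualCone C).smul_mem (by positivity) hf, ?_, ?_,
    fun z hz h0 => h z hz ?_⟩
  · rw [real_inner_smul_left, hfx, mul_zero]
  · rw [real_inner_smul_left, inv_mul_cancel₀ hpos.ne']
  · rw [real_inner_smul_left] at h0
    exact (mul_eq_zero.1 h0).resolve_left (by positivity)

variable [FiniteDimensional ℝ V]

/-- Optimal pairs for a pair of strictly positive elements of the cone and its dual. -/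
theorem exists_optimal_pair {C : Set V} (hC : IsProperCone C) {N p x₀ f₀ : V}
    (hN : ∀ x ∈ C, x ≠ 0 → 0 < ⟪N, x⟫) (hp : ∀ f ∈ dualCone C, f ≠ 0 → 0 < ⟪f, p⟫)
    (hx₀ : x₀ ∈ C) (hNx₀ : ⟪N, x₀⟫ = 1) (hf₀ : f₀ ∈ dualCone C) (hf₀p : ⟪f₀, p⟫ = 1) :
    ∃ x ∈ C, ∃ g ∈ dualCone C, ⟪N, x⟫ = 1 ∧ ⟪g, p⟫ = 1 ∧ ⟪f₀, x₀⟫ ≤ ⟪g, x⟫ ∧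
      ∀ y ∈ C, ∀ f ∈ dualCone C, ⟪f, y⟫ ≤ ⟪g, x⟫ * (⟪f, p⟫ * ⟪N, y⟫) := by
  have hK := (isCompact_base hC.toIsClosedCone hN).prod
    (isCompact_base (isClosedCone_dualCone C) (e := p)
      fun f hf hf0 => by rw [real_inner_comm]; exact hp f hf hf0)
  have h0 : (x₀, f₀) ∈ {x ∈ C | ⟪N, x⟫ = 1} ×ˢ {f ∈ dualCone C | ⟪p, f⟫ = 1} :=
    ⟨⟨hx₀, hNx₀⟩, hf₀, by rwa [real_inner_comm]⟩
  obtain ⟨⟨x, g⟩, ⟨⟨hxC, hNx⟩, hgC, hgp⟩, hmax⟩ := hK.exists_isMaxOn ⟨_, h0⟩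
    (f := fun q => ⟪q.2, q.1⟫) (by fun_prop)
  refine ⟨x, hxC, g, hgC, hNx, by rwa [real_inner_comm], hmax h0, fun y hy f hf => ?_⟩
  by_cases hy0 : y = 0
  · simp [hy0]
  by_cases hf0 : f = 0
  · simp [hf0]
  have h1 := hN y hy hy0
  have h2 := hp f hf hf0
  have h3 : ⟪⟪f, p⟫⁻¹ • f, ⟪N, y⟫⁻¹ • y⟫ ≤ ⟪g, x⟫ := hmax (a := (⟪N, y⟫⁻¹ • y, ⟪f, p⟫⁻¹ • f))
    ⟨⟨hC.smul_mem (by positivity) hy, by rw [real_inner_smul_right]; field_simp⟩,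
      (isClosedCone_dualCone C).smul_mem (by positivity) hf, by
        rw [real_inner_smul_right, real_inner_comm f p, inv_mul_cancel₀ h2.ne']⟩
  rw [real_inner_smul_left, real_inner_smul_right] at h3
  calc ⟪f, y⟫ = (⟪f, p⟫⁻¹ * (⟪N, y⟫⁻¹ * ⟪f, y⟫)) * (⟪f, p⟫ * ⟪N, y⟫) := by field_simp
    _ ≤ _ := mul_le_mul_of_nonneg_right h3 (by positivity)

theorem nonempty_sandwich_of_exposedRay {C : Set V} (hC : IsProperCone C) {e x₁ x₃ z : V}
    (h₁ : ExposedRay C x₁) (h₃ : ExposedRay C x₃) (hz : ExposedRay C z) (he₁ : ⟪e, x₁⟫ = 1)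
    (he₃ : ⟪e, x₃⟫ = 1) (hez : ⟪e, z⟫ = 1) (h₁₃ : x₁ ≠ x₃) (hz₁ : z ≠ x₁) (hz₃ : z ≠ x₃)
    (hp : ∀ f ∈ dualCone C, f ≠ 0 → 0 < ⟪f, x₁ + x₃⟫) : Nonempty (Sandwich C) := by
  obtain ⟨f₁, hf₁, h11, h13, hray₁⟩ := h₁.exists_normalized he₁ h₃.mem he₃ h₁₃.symm
  obtain ⟨f₃, hf₃, h33, h31, hray₃⟩ := h₃.exists_normalized he₃ h₁.mem he₁ h₁₃
  have hN : ∀ x ∈ C, x ≠ 0 → 0 < ⟪f₁ + f₃, x⟫ := by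
    intro x hx hx0
    rw [inner_add_left]
    refine lt_of_le_of_ne (add_nonneg (hf₁ x hx) (hf₃ x hx)) fun h0 => hx0 ?_
    have e1 : ⟪f₁, x⟫ = 0 := by linarith [hf₁ x hx, hf₃ x hx]
    have e3 : ⟪f₃, x⟫ = 0 := by linarith [hf₁ x hx, hf₃ x hx]
    have h := hray₁ x hx e1
    rw [h, real_inner_smul_right, h31, mul_one] at e3
    rw [h, e3, zero_smul]
  obtain ⟨x, hx, g, hg, hNx, hgp, hM, hopt⟩ := exists_optimal_pair hC hN hp h₃.mem
    (by rw [inner_add_left, h13, h33, add_zero]) hf₁ (by rw [inner_add_right, h11, h13, zero_add])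
  rw [h13] at hM
  generalize hMdef : ⟪g, x⟫ = M at *
  have hMpos : 0 < M := by linarith
  have hdual := isClosedCone_dualCone C
  simp only [inner_add_left, inner_add_right] at hopt hNx hgp
  obtain rfl | hM := hM.eq_or_lt
  · obtain ⟨f, hf, hfz, hrayz⟩ := hz.exists_eq_smul hez
    have hfx₁ := pos_of_forall_eq_smul hf hrayz h₁.mem he₁ hz₁.symm
    have hfx₃ := pos_of_forall_eq_smul hf hrayz h₃.mem he₃ hz₃.symm
    have h1z := pos_of_forall_eq_smul hf₁ hray₁ hz.mem hez hz₁
    have h3z := pos_of_forall_eq_smul hf₃ hray₃ hz.mem hez hz₃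
    set s := ⟪f, x₁⟫ + ⟪f, x₃⟫ with hs
    set n := ⟪f₁, z⟫ + ⟪f₃, z⟫ with hn
    have hspos : 0 < s := by positivity
    have hnpos : 0 < n := by positivity
    have hval : ∀ y ∈ C, (⟪f₁, y⟫ = 0 ∨ ⟪f₃, y⟫ = 0) →
        (⟪s⁻¹ • f, y⟫ = 0 ∨ ⟪f₁ + f₃ - s⁻¹ • f, y⟫ = 0) → y = 0 := by
      intro y hy hy1 hy2
      rw [inner_sub_left, inner_add_left, real_inner_smul_left] at hy2
      obtain h | h := hy1
      · have hy' := hray₁ y hy h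
        have : ⟪e, y⟫ = 0 := by
          generalize ⟪e, y⟫ = t at hy'
          rw [hy'] at hy2
          simp only [real_inner_smul_right, h11, h31] at hy2
          obtain h | h := hy2
          · simpa [hspos.ne', hfx₁.ne'] using h
          · field_simp at h
            have : t * ⟪f, x₃⟫ = 0 := by rw [hs] at h; linarith
            exact (mul_eq_zero.1 this).resolve_right hfx₃.ne'
        rw [hy', this, zero_smul]
      · have hy' := hray₃ y hy h
        have : ⟪e, y⟫ = 0 := by
          generalize ⟪e, y⟫ = t at hy'
          rw [hy'] at hy2
          simp only [real_inner_smul_right, h13, h33] at hy2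
          obtain h | h := hy2
          · simpa [hspos.ne', hfx₃.ne'] using h
          · field_simp at h
            have : t * ⟪f, x₁⟫ = 0 := by rw [hs] at h; linarith
            exact (mul_eq_zero.1 this).resolve_right hfx₁.ne'
        rw [hy', this, zero_smul]
    exact ⟨{
      z₁ := x₁, z₂ := n⁻¹ • z, z₃ := x₃, z₄ := x₁ + x₃ - n⁻¹ • z
      f₁ := f₁, f₂ := s⁻¹ • f, f₃ := f₃, f₄ := f₁ + f₃ - s⁻¹ • f
      φ := f₁, χ := s⁻¹ • f
      z₁_mem := h₁.mem
      z₂_mem := hC.smul_mem (by positivity) hz.mem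
      z₃_mem := h₃.mem
      z₄_mem := hC.mem_of_dual fun h hh => by
        have := hopt z hz.mem h hh
        rw [inner_sub_right, inner_add_right, real_inner_smul_right, sub_nonneg,
          inv_mul_le_iff₀ hnpos]
        linarith
      f₁_mem := hf₁
      f₂_mem := hdual.smul_mem (by positivity) hf
      f₃_mem := hf₃
      f₄_mem := fun y hy => by
        have := hopt y hy f hf
        rw [inner_sub_left, inner_add_left, real_inner_smul_left, sub_nonneg,
          inv_mul_le_iff₀ hspos]
        linarith
      z_add := by abel
      f_add := by abel
      inner₁ := h11
      inner₂ := by rw [real_inner_smul_left, real_inner_smul_right, hfz]; ring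
      inner₃ := h33
      inner₄ := by
        simp only [inner_sub_left, inner_sub_right, inner_add_left, inner_add_right,
          real_inner_smul_left, real_inner_smul_right, h11, h13, h31, h33, hfz]
        have e1 : n⁻¹ * ⟪f₁, z⟫ + n⁻¹ * ⟪f₃, z⟫ = 1 := by
          rw [← mul_add, ← hn, inv_mul_cancel₀ hnpos.ne']
        have e2 : s⁻¹ * ⟪f, x₁⟫ + s⁻¹ * ⟪f, x₃⟫ = 1 := by
          rw [← mul_add, ← hs, inv_mul_cancel₀ hspos.ne']
        linarith
      corner := fun y hy h h' => by simp [hval y hy h h']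
      indep := fun a b e1 e2 e3 => by
        simp only [real_inner_smul_left, real_inner_smul_right, h11, hfz, mul_zero, add_zero,
          zero_add] at e1 e2
        simp only [mul_eq_zero, inv_eq_zero, hspos.ne', hnpos.ne', hfx₁.ne', h1z.ne',
          or_false] at e1 e2
        exact ⟨e2, e1⟩ }⟩
  · have hgsum : ⟪M⁻¹ • g, x₁⟫ + ⟪M⁻¹ • g, x₃⟫ = M⁻¹ := by
      rw [real_inner_smul_left, real_inner_smul_left, ← mul_add, hgp, mul_one]
    have hMinv : M⁻¹ < 1 := inv_lt_one_of_one_lt₀ hM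
    have hf₂ : M⁻¹ • g ∈ dualCone C := hdual.smul_mem (by positivity) hg
    have hz₄ : M⁻¹ • x ∈ C := hC.smul_mem (by positivity) hx
    have hz₂ : x₁ + x₃ - M⁻¹ • x ∈ C := hC.mem_of_dual fun h hh => by
      have := hopt x hx h hh
      rw [inner_sub_right, inner_add_right, real_inner_smul_right, sub_nonneg,
        inv_mul_le_iff₀ hMpos]
      rw [hNx] at this
      linarith
    have hf₄ : f₁ + f₃ - M⁻¹ • g ∈ dualCone C := fun y hy => by
      have := hopt y hy g hg
      rw [inner_sub_left, inner_add_left, real_inner_smul_left, sub_nonneg,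
        inv_mul_le_iff₀ hMpos]
      rw [hgp] at this
      linarith
    have hinner₂ : ⟪M⁻¹ • g, x₁ + x₃ - M⁻¹ • x⟫ = 0 := by
      rw [inner_sub_right, inner_add_right, hgsum, real_inner_smul_left, real_inner_smul_right,
        hMdef]
      field_simp; ring
    have hinner₄ : ⟪f₁ + f₃ - M⁻¹ • g, M⁻¹ • x⟫ = 0 := by
      rw [inner_sub_left, inner_add_left, real_inner_smul_left, real_inner_smul_right,
        real_inner_smul_right, real_inner_smul_right, hMdef, ← mul_add, hNx]
      field_simp; ring
    have hNz : ⟪f₁, M⁻¹ • x⟫ + ⟪f₃, M⁻¹ • x⟫ = M⁻¹ := by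
      rw [real_inner_smul_right, real_inner_smul_right, ← mul_add, hNx, mul_one]
    generalize M⁻¹ • g = f₂ at *
    generalize M⁻¹ • x = z₄ at *
    have hf₂1 := hf₂ x₁ h₁.mem
    have hf₂3 := hf₂ x₃ h₃.mem
    have hMinv' : 0 < M⁻¹ := by positivity
    have hc₁ : ∀ y ∈ C, ⟪f₁, y⟫ = 0 → (⟪f₂, y⟫ = 0 ∨ ⟪f₁ + f₃ - f₂, y⟫ = 0) →
        ⟪f₂, y⟫ = 0 := by
      intro y hy h hy2
      have hy' := hray₁ y hy h
      generalize ⟪e, y⟫ = t at hy'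
      subst hy'
      refine hy2.elim id fun h' => ?_
      simp only [inner_sub_left, inner_add_left, real_inner_smul_right, h11, h31] at h'
      have : t * (1 - ⟪f₂, x₁⟫) = 0 := by linarith
      have ht : t = 0 := (mul_eq_zero.1 this).resolve_right (by linarith)
      rw [ht]; simp
    have hc₃ : ∀ y ∈ C, ⟪f₃, y⟫ = 0 → (⟪f₂, y⟫ = 0 ∨ ⟪f₁ + f₃ - f₂, y⟫ = 0) →
        ⟪f₂, y⟫ = 0 := by
      intro y hy h hy2
      have hy' := hray₃ y hy h
      generalize ⟪e, y⟫ = t at hy'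
      subst hy'
      refine hy2.elim id fun h' => ?_
      simp only [inner_sub_left, inner_add_left, real_inner_smul_right, h13, h33] at h'
      have : t * (1 - ⟪f₂, x₃⟫) = 0 := by linarith
      have ht : t = 0 := (mul_eq_zero.1 this).resolve_right (by linarith)
      rw [ht]; simp
    have hS : ∀ φ : V, (∀ y ∈ C, (⟪f₁, y⟫ = 0 ∨ ⟪f₃, y⟫ = 0) → ⟪f₂, y⟫ = 0 → ⟪φ, y⟫ = 0) →
        ⟪φ, x₁ + x₃ - z₄⟫ ≠ 0 → Nonempty (Sandwich C) := by
      intro φ hφ hφz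
      exact ⟨{
        z₁ := x₁, z₂ := x₁ + x₃ - z₄, z₃ := x₃, z₄ := z₄
        f₁ := f₁, f₂ := f₂, f₃ := f₃, f₄ := f₁ + f₃ - f₂
        φ := φ, χ := f₂
        z₁_mem := h₁.mem
        z₂_mem := hz₂
        z₃_mem := h₃.mem
        z₄_mem := hz₄
        f₁_mem := hf₁
        f₂_mem := hf₂
        f₃_mem := hf₃
        f₄_mem := hf₄
        z_add := by abel
        f_add := by abel
        inner₁ := h11
        inner₂ := hinner₂
        inner₃ := h33
        inner₄ := hinner₄
        corner := fun y hy h h' => by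
          have h2 : ⟪f₂, y⟫ = 0 := h.elim (fun h => hc₁ y hy h h') (fun h => hc₃ y hy h h')
          exact ⟨hφ y hy h h2, h2⟩
        indep := fun a b e1 e2 e3 => by
          rw [hinner₂, mul_zero, add_zero] at e2
          have ha : a = 0 := (mul_eq_zero.1 e2).resolve_right hφz
          subst ha
          refine ⟨rfl, ?_⟩
          have : b * M⁻¹ = 0 := by rw [← hgsum]; linarith
          exact (mul_eq_zero.1 this).resolve_right hMinv'.ne' }⟩
    by_cases h23 : ⟪f₂, x₃⟫ = 0
    · refine hS f₃ (fun y hy h h2 => h.elim (fun h => ?_) id) fun h0 => ?_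
      · have hy' := hray₁ y hy h
        generalize ⟪e, y⟫ = t at hy'
        subst hy'
        rw [real_inner_smul_right] at h2
        have ht : t = 0 := (mul_eq_zero.1 h2).resolve_right (by linarith)
        rw [ht]; simp
      · have h := hray₃ _ hz₂ h0
        generalize ⟪e, x₁ + x₃ - z₄⟫ = t at h
        have h' : z₄ = x₁ + (1 - t) • x₃ := by
          rw [sub_smul, one_smul, ← h]; abel
        have h'' := hf₁ _ hz₄
        rw [h', inner_add_right, real_inner_smul_right, h11, h13] at h''
        rw [h', inner_add_right, real_inner_smul_right, h11, h13, inner_add_right,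
          real_inner_smul_right, h31, h33] at hNz
        linarith
    · refine hS f₁ (fun y hy h h2 => h.elim id (fun h => ?_)) fun h0 => ?_
      · have hy' := hray₃ y hy h
        generalize ⟪e, y⟫ = t at hy'
        subst hy'
        rw [real_inner_smul_right] at h2
        have ht : t = 0 := (mul_eq_zero.1 h2).resolve_right h23
        rw [ht]; simp
      · have h := hray₁ _ hz₂ h0
        generalize ⟪e, x₁ + x₃ - z₄⟫ = t at h
        have h' : z₄ = x₃ + (1 - t) • x₁ := by
          rw [sub_smul, one_smul, ← h]; abel
        have h'' := hf₃ _ hz₄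
        rw [h', inner_add_right, real_inner_smul_right, h31, h33] at h''
        rw [h', inner_add_right, real_inner_smul_right, h11, h13, inner_add_right,
          real_inner_smul_right, h31, h33] at hNz
        linarith

end

section

theorem exists_le_mul_of_finite {α : Type*} {S : Set α} (hS : S.Finite) {A B : α → ℝ}
    (hB : ∀ v ∈ S, 0 ≤ B v) (hAB : ∀ v ∈ S, B v = 0 → A v ≤ 0) :
    ∃ t : ℝ, 0 ≤ t ∧ ∀ v ∈ S, A v ≤ t * B v := by
  obtain ⟨t, ht⟩ := (hS.image fun v => A v / B v).bddAbove
  refine ⟨max t 0, le_max_right _ _, fun v hv => ?_⟩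
  obtain h | h := (hB v hv).eq_or_lt
  · rw [← h, mul_zero]; exact hAB v hv h.symm
  · rw [← div_le_iff₀ h]
    exact (ht ⟨v, hv, rfl⟩).trans (le_max_left _ _)

variable {V : Type*} [NormedAddCommGroup V] [InnerProductSpace ℝ V]

theorem exists_family_of_isSimplicial_exposedFace {C : Set V} {f : V}
    (h : IsSimplicial (exposedFace C f)) : ∃ (n : ℕ) (b : Fin n → V), LinearIndependent ℝ b ∧
      (∀ i, b i ∈ C ∧ ⟪f, b i⟫ = 0) ∧
      ∀ x ∈ C, ⟪f, x⟫ = 0 → ∃ c : Fin n → ℝ, (∀ i, 0 ≤ c i) ∧ x = ∑ i, c i • b i := by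
  obtain ⟨n, b, hb, hbF⟩ := h
  refine ⟨n, fun i => b i, hb.map' (Submodule.subtype _) (Submodule.ker_subtype _), fun i => ?_,
    fun x hx hfx => ?_⟩
  · have : b i ∈ exposedFace C f := by
      classical
      rw [hbF]
      exact ⟨Pi.single i 1, fun j => by by_cases h : j = i <;> simp [h],
        by simp [Pi.single_apply]⟩
    exact ⟨this, inner_eq_zero_of_mem_span_face (b i).2⟩
  · have : (⟨x, Submodule.subset_span ⟨hx, hfx⟩⟩ : Submodule.span ℝ {x ∈ C | ⟪f, x⟫ = 0}) ∈
        exposedFace C f := hx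
    rw [hbF] at this
    obtain ⟨c, hc, hxc⟩ := this
    exact ⟨c, hc, by simpa using congrArg Subtype.val hxc⟩

/-- An exposed ray contained in a finitely generated subcone is one of the generators. -/
theorem ExposedRay.exists_eq_of_sum {C : Set V} {ι : Type*} [Fintype ι] {v e : V} {b : ι → V}
    {c : ι → ℝ} (h : ExposedRay C v) (hev : ⟪e, v⟫ = 1) (hb : ∀ i, b i ∈ C)
    (hc : ∀ i, 0 ≤ c i) (hv : v = ∑ i, c i • b i) : ∃ i, c i ≠ 0 ∧ b i = ⟪e, b i⟫ • v := by
  obtain ⟨f, hf, hfv, hray⟩ := h.exists_eq_smul hev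
  have h0 : ∑ i, c i * ⟪f, b i⟫ = 0 := by
    rw [← hfv]
    conv_rhs => rw [hv]
    simp [inner_sum, real_inner_smul_right]
  rw [Finset.sum_eq_zero_iff_of_nonneg fun i _ => mul_nonneg (hc i) (hf _ (hb i))] at h0
  obtain ⟨i, hi⟩ : ∃ i, c i ≠ 0 := by
    by_contra! hall
    exact h.ne_zero (by rw [hv]; simp [hall])
  exact ⟨i, hi, hray _ (hb i) ((mul_eq_zero.1 (h0 i (Finset.mem_univ i))).resolve_left hi)⟩

variable [FiniteDimensional ℝ V]

theorem isSimplicial_of_exposedRay {ι : Type*} [Fintype ι] {b : ι → V} {C : Set V} {e : V}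
    (hC : IsClosedCone C) (he : ∀ x ∈ C, x ≠ 0 → 0 < ⟪e, x⟫) (hb : LinearIndependent ℝ b)
    (hbC : ∀ i, b i ∈ C) (h : ∀ v, ExposedRay C v → ⟪e, v⟫ = 1 → ∃ i, v = b i) :
    IsSimplicial C :=
  isSimplicial_of_forall_dual hC hb hbC fun g hg =>
    mem_dualCone_of_exposedRay hC he fun v hv hev => by
      obtain ⟨i, rfl⟩ := h v hv hev
      exact hg i

/-- Cones all of whose proper exposed faces are simplicial, in which any two exposed rays lie in a
common proper exposed face, and whose dual cone has a simplicial face at an exposed ray. -/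
theorem isSimplicial_of_pairwise {C : Set V} (hC : IsClosedCone C) {e x : V}
    (he : ∀ x ∈ C, x ≠ 0 → 0 < ⟪e, x⟫) (hx : ExposedRay C x) (hex : ⟪e, x⟫ = 1)
    (hface : ∀ f ∈ dualCone C, f ≠ 0 → IsSimplicial (exposedFace C f))
    (hdual : IsSimplicial (exposedFace (dualCone C) x))
    (hpair : ∀ v, ExposedRay C v → ⟪e, v⟫ = 1 → v ≠ x →
      ∃ g ∈ dualCone C, g ≠ 0 ∧ ⟪g, x⟫ = 0 ∧ ⟪g, v⟫ = 0) : IsSimplicial C := by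
  classical
  obtain ⟨n, h, hli, hmem, hgen⟩ := exists_family_of_isSimplicial_exposedFace hdual
  have hhx : ∀ i, ⟪h i, x⟫ = 0 := fun i => by rw [real_inner_comm]; exact (hmem i).2
  have hpos : ∀ i, ∀ v ∈ C, 0 ≤ ⟪h i, v⟫ := fun i => (hmem i).1
  set Ex : Set V := {v | ExposedRay C v ∧ ⟪e, v⟫ = 1} with hEx
  have hzero : ∀ v ∈ Ex, v ≠ x → ∃ k, ⟪h k, v⟫ = 0 := by
    rintro v ⟨hv, hev⟩ hvx
    obtain ⟨g, hg, hg0, hgx, hgv⟩ := hpair v hv hev hvx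
    obtain ⟨c, hc, rfl⟩ := hgen g hg (by rwa [real_inner_comm])
    obtain ⟨k, hk⟩ : ∃ k, c k ≠ 0 := by
      by_contra! hall
      exact hg0 (by simp [hall])
    rw [sum_inner, Finset.sum_eq_zero_iff_of_nonneg] at hgv
    · have := hgv k (Finset.mem_univ k)
      rw [real_inner_smul_left] at this
      exact ⟨k, (mul_eq_zero.1 this).resolve_left hk⟩
    · intro i _
      rw [real_inner_smul_left]
      exact mul_nonneg (hc i) (hpos i v hv.mem)
  have hfaces : ∀ k, ∃ (m : ℕ) (T : Fin m → V), LinearIndependent ℝ T ∧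
      ∀ v ∈ Ex, ⟪h k, v⟫ = 0 → ∃ a, v = ⟪e, T a⟫⁻¹ • T a ∧ ⟪e, T a⟫⁻¹ ≠ 0 := by
    intro k
    obtain ⟨m, T, hT, hTC, hTgen⟩ :=
      exists_family_of_isSimplicial_exposedFace (hface (h k) (hmem k).1 (hli.ne_zero k))
    refine ⟨m, T, hT, fun v hv hkv => ?_⟩
    obtain ⟨c, hc, hvc⟩ := hTgen v hv.1.mem hkv
    obtain ⟨a, -, ha⟩ := hv.1.exists_eq_of_sum hv.2 (fun i => (hTC i).1) hc hvc
    have := he _ (hTC a).1 (hT.ne_zero a)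
    refine ⟨a, ?_, by positivity⟩
    rw [eq_inv_smul_iff₀ this.ne', ← ha]
  have hfin : Ex.Finite := by
    choose m T hT hTEx using hfaces
    refine Set.Finite.subset (s := {x} ∪ ⋃ k, Set.range fun a => ⟪e, T k a⟫⁻¹ • T k a)
      ((Set.finite_singleton x).union (Set.finite_iUnion fun k => Set.finite_range _)) ?_
    intro v hv
    by_cases hvx : v = x
    · exact Or.inl hvx
    · obtain ⟨k, hk⟩ := hzero v hv hvx
      obtain ⟨a, ha, -⟩ := hTEx k v hv hk
      exact Or.inr (Set.mem_iUnion.2 ⟨k, a, ha.symm⟩)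
  have hvert : ∀ i, ∃ v ∈ Ex, 0 < ⟪h i, v⟫ ∧ ∀ j, j ≠ i → ⟪h j, v⟫ = 0 := by
    intro i
    by_contra! hno
    have hH : ∀ v ∈ C, 0 ≤ ∑ j ∈ Finset.univ.erase i, ⟪h j, v⟫ := fun v hv =>
      Finset.sum_nonneg fun j _ => hpos j v hv
    obtain ⟨t, ht, htv⟩ := exists_le_mul_of_finite hfin (A := fun v => ⟪h i, v⟫)
      (B := fun v => ∑ j ∈ Finset.univ.erase i, ⟪h j, v⟫) (fun v hv => hH v hv.1.mem)
      fun v hv h0 => by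
        by_contra! hcon
        obtain ⟨j, hji, hj⟩ := hno v hv hcon
        rw [Finset.sum_eq_zero_iff_of_nonneg fun j _ => hpos j v hv.1.mem] at h0
        exact hj (h0 j (by simp [hji]))
    have hmemC : t • ∑ j ∈ Finset.univ.erase i, h j - h i ∈ dualCone C :=
      mem_dualCone_of_exposedRay hC he fun v hv hev => by
        have := htv v ⟨hv, hev⟩
        rw [inner_sub_left, real_inner_smul_left, sum_inner]
        linarith
    obtain ⟨c, hc, hceq⟩ := hgen _ hmemC (by
      rw [real_inner_comm, inner_sub_left, real_inner_smul_left, sum_inner]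
      simp [hhx])
    obtain ⟨l, hl⟩ := exists_biorthogonal hli
    have := congrArg (fun w => ⟪l i, w⟫) hceq
    simp only [inner_sum_biorthogonal hl, inner_sub_right, real_inner_smul_right, inner_sum,
      hl] at this
    rw [Finset.sum_eq_zero fun j hj => if_neg (Finset.ne_of_mem_erase hj).symm] at this
    have := hc i
    simp at *
    linarith
  obtain ⟨fx, hfx, hfxx, hrayx⟩ := hx.exists_eq_smul hex
  have hspan : ∀ g, ⟪g, x⟫ = 0 → g ∈ Submodule.span ℝ (Set.range h) := by
    have hdualspan : ∀ g ∈ dualCone C, ⟪g, x⟫ = 0 → g ∈ Submodule.span ℝ (Set.range h) := by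
      intro g hg hgx
      obtain ⟨c, -, rfl⟩ := hgen g hg (by rwa [real_inner_comm])
      exact Submodule.sum_mem _ fun i _ => Submodule.smul_mem _ _ (Submodule.subset_span ⟨i, rfl⟩)
    intro g hgx
    obtain ⟨t, ht, htv⟩ := exists_le_mul_of_finite hfin (A := fun v => -⟪g, v⟫)
      (B := fun v => ⟪fx, v⟫) (fun v hv => hfx v hv.1.mem) fun v hv h0 => by
        have := hrayx v hv.1.mem h0
        rw [hv.2, one_smul] at this
        rw [this, hgx, neg_zero]
    have h1 : g + t • fx ∈ dualCone C := mem_dualCone_of_exposedRay hC he fun v hv hev => by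
      have := htv v ⟨hv, hev⟩
      rw [inner_add_left, real_inner_smul_left]
      linarith
    have h2 := hdualspan _ h1 (by rw [inner_add_left, real_inner_smul_left, hgx, hfxx]; ring)
    have h3 := Submodule.sub_mem _ h2 (Submodule.smul_mem _ t (hdualspan fx hfx hfxx))
    rwa [add_sub_cancel_right] at h3
  have hker : ∀ u, (∀ i, ⟪h i, u⟫ = 0) → ∃ t : ℝ, u = t • x := by
    intro u hu
    have hxx : ⟪x, x⟫ ≠ 0 := by simpa using hx.ne_zero
    set g := u - (⟪u, x⟫ / ⟪x, x⟫) • x with hg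
    have hgx : ⟪g, x⟫ = 0 := by
      rw [hg, inner_sub_left, real_inner_smul_left, div_mul_cancel₀ _ hxx, sub_self]
    have hgu : ⟪g, u⟫ = 0 := by
      have : Submodule.span ℝ (Set.range h) ≤ LinearMap.ker (innerₗ V u) := by
        rw [Submodule.span_le]
        rintro _ ⟨i, rfl⟩
        exact (real_inner_comm _ _).trans (hu i)
      exact (real_inner_comm _ _).trans (this (hspan g hgx))
    refine ⟨⟪u, x⟫ / ⟪x, x⟫, sub_eq_zero.1 ?_⟩
    rw [← hg, ← inner_self_eq_zero (𝕜 := ℝ)]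
    conv_lhs => rw [hg]
    rw [inner_sub_left, real_inner_smul_left, real_inner_comm g u, hgu, real_inner_comm g x, hgx]
    simp
  choose v hvEx hvpos hvzero using hvert
  refine isSimplicial_of_exposedRay (ι := Option (Fin n)) (b := fun o => o.elim x v) hC he ?_ ?_ ?_
  · rw [Fintype.linearIndependent_iff]
    intro c hc
    rw [Fintype.sum_option] at hc
    simp only [Option.elim_none, Option.elim_some] at hc
    have hsome : ∀ j, c (some j) = 0 := by
      intro j
      have := congrArg (fun w => ⟪h j, w⟫) hc
      simp only [inner_add_right, real_inner_smul_right, hhx, inner_sum, inner_zero_right] at this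
      rw [Finset.sum_eq_single j (fun i _ hij => by rw [hvzero i j hij.symm, mul_zero])
        (by simp)] at this
      simpa [(hvpos j).ne'] using this
    rintro (_ | j)
    · simpa [hsome, hx.ne_zero] using hc
    · exact hsome j
  · rintro (_ | j)
    · exact hx.mem
    · exact (hvEx j).1.mem
  · intro w hw hew
    by_cases hwx : w = x
    · exact ⟨none, hwx⟩
    have hc : ∀ i, 0 ≤ ⟪h i, w⟫ / ⟪h i, v i⟫ := fun i =>
      div_nonneg (hpos i w hw.mem) (hvpos i).le
    obtain ⟨t, ht⟩ := hker (w - ∑ i, (⟪h i, w⟫ / ⟪h i, v i⟫) • v i) fun j => by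
      simp only [inner_sub_right, inner_sum, real_inner_smul_right]
      rw [Finset.sum_eq_single j (fun i _ hij => by rw [hvzero i j hij.symm, mul_zero])
        (by simp), div_mul_cancel₀ _ (hvpos j).ne', sub_self]
    obtain ⟨k, hk⟩ := hzero w ⟨hw, hew⟩ hwx
    obtain ⟨m, T, hT, hTEx⟩ := hfaces k
    obtain ⟨l, hl⟩ := exists_biorthogonal hT
    obtain ⟨a, ha, ha0⟩ := hTEx x ⟨hx, hex⟩ (hhx k)
    have hla : ∀ y ∈ Ex, ⟪h k, y⟫ = 0 → y ≠ x → ⟪l a, y⟫ = 0 := by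
      intro y hy hky hyx
      obtain ⟨b, hb, -⟩ := hTEx y hy hky
      have hab : a ≠ b := by rintro rfl; exact hyx (hb.trans ha.symm)
      rw [hb, real_inner_smul_right, hl, if_neg hab, mul_zero]
    have hlx : ⟪l a, x⟫ ≠ 0 := by
      rw [ha, real_inner_smul_right, hl, if_pos rfl, mul_one]; exact ha0
    have ht0 : t = 0 := by
      have := congrArg (fun y => ⟪l a, y⟫) ht
      simp only [inner_sub_right, inner_sum, real_inner_smul_right] at this
      rw [hla w ⟨hw, hew⟩ hk hwx, Finset.sum_eq_zero, sub_zero] at this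
      · exact (mul_eq_zero.1 this.symm).resolve_right hlx
      · intro i _
        by_cases hik : i = k
        · rw [hik, hk, zero_div, zero_mul]
        · rw [hla (v i) (hvEx i) (hvzero i k (Ne.symm hik)), mul_zero]
          intro hvx
          exact (hvpos i).ne' (by rw [hvx, hhx])
    rw [ht0, zero_smul, sub_eq_zero] at ht
    obtain ⟨i, -, hi⟩ := hw.exists_eq_of_sum hew (fun i => (hvEx i).1.mem) hc ht
    rw [(hvEx i).2, one_smul] at hi
    exact ⟨some i, hi.symm⟩

theorem nonempty_sandwich {C : Set V} (hC : IsProperCone C) (hns : ¬ IsSimplicial C)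
    (hface : ∀ f ∈ dualCone C, f ≠ 0 → IsSimplicial (exposedFace C f))
    (hdual : ∀ x ∈ C, x ≠ 0 → IsSimplicial (exposedFace (dualCone C) x)) :
    Nonempty (Sandwich C) := by
  obtain ⟨e, he⟩ := hC.exists_pos
  have hcl := hC.toIsClosedCone
  obtain ⟨x, hx, hex⟩ : ∃ x, ExposedRay C x ∧ ⟪e, x⟫ = 1 := by
    by_contra! hno
    exact hns (isSimplicial_of_exposedRay (ι := Fin 0) (b := Fin.elim0) hcl he
      (linearIndependent_empty_type) (fun i => i.elim0) fun v hv hev => absurd hev (hno v hv))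
  by_cases hpair : ∃ y, ExposedRay C y ∧ ⟪e, y⟫ = 1 ∧ y ≠ x ∧
      ∀ g ∈ dualCone C, g ≠ 0 → 0 < ⟪g, x + y⟫
  · obtain ⟨y, hy, hey, hyx, hg⟩ := hpair
    by_cases hthird : ∃ z, ExposedRay C z ∧ ⟪e, z⟫ = 1 ∧ z ≠ x ∧ z ≠ y
    · obtain ⟨z, hz, hez, hzx, hzy⟩ := hthird
      exact nonempty_sandwich_of_exposedRay hC hx hy hz hex hey hez hyx.symm hzx hzy hg
    · push Not at hthird
      refine absurd (isSimplicial_of_exposedRay (b := ![x, y]) hcl he ?_ ?_ fun v hv hev => ?_) hns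
      · rw [LinearIndependent.pair_iff]
        intro s t hst
        obtain ⟨f, -, hfx, hfy, -⟩ := hx.exists_normalized hex hy.mem hey hyx
        have h1 := congrArg (fun w => ⟪f, w⟫) hst
        simp only [inner_add_right, real_inner_smul_right, hfx, hfy, inner_zero_right] at h1
        have ht : t = 0 := by linarith
        subst ht
        exact ⟨by simpa [hx.ne_zero] using hst, rfl⟩
      · intro i
        fin_cases i
        · exact hx.mem
        · exact hy.mem
      · by_cases hvx : v = x
        · exact ⟨0, hvx⟩
        · exact ⟨1, hthird v hv hev hvx⟩
  · push Not at hpair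
    refine absurd (isSimplicial_of_pairwise hcl he hx hex hface (hdual x hx.mem hx.ne_zero)
      fun v hv hev hvx => ?_) hns
    obtain ⟨g, hg, hg0, hgle⟩ := hpair v hv hev hvx
    rw [inner_add_right] at hgle
    exact ⟨g, hg, hg0, by linarith [hg x hx.mem, hg v hv.mem],
      by linarith [hg x hx.mem, hg v hv.mem]⟩

end

section

universe u v

theorem Nuclear.isSimplicial_or_of_finrank_le (n : ℕ) : ∀ {V : Type u} {W : Type v}
    [NormedAddCommGroup V] [InnerProductSpace ℝ V] [FiniteDimensional ℝ V]
    [NormedAddCommGroup W] [InnerProductSpace ℝ W] [FiniteDimensional ℝ W]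
    {C : Set V} {D : Set W}, Module.finrank ℝ V + Module.finrank ℝ W < n →
    IsProperCone C → IsProperCone D → Nuclear C D → IsSimplicial C ∨ IsSimplicial D := by
  induction n with
  | zero => intros; omega
  | succ n ih =>
    intro V W _ _ _ _ _ _ C D hn hC hD h
    by_contra! hns
    have mem_dd : ∀ {x}, x ∈ C → x ∈ dualCone (dualCone C) := fun hx => by
      rwa [hC.dualCone_dualCone]
    have mem_dd' : ∀ {x}, x ∈ D → x ∈ dualCone (dualCone D) := fun hx => by
      rwa [hD.dualCone_dualCone]
    obtain ⟨S⟩ := nonempty_sandwich hC hns.1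
      (fun f hf hf0 => (ih (by have := finrank_exposedFace_lt C hf0; omega) (hC.exposedFace f) hD
        (h.exposedFace hD hf)).resolve_right hns.2)
      (fun x hx hx0 => (ih (by have := finrank_exposedFace_lt (dualCone C) hx0; omega)
        (hC.dual.exposedFace x) hD.dual
        ((h.dual hC hD).exposedFace hD.dual (mem_dd hx))).resolve_right
          fun h' => hns.2 (h'.of_dualCone hD))
    obtain ⟨T⟩ := nonempty_sandwich hD hns.2
      (fun f hf hf0 => (ih (by have := finrank_exposedFace_lt D hf0; omega) hC (hD.exposedFace f)
        (h.symm.exposedFace hC hf).symm).resolve_left hns.1)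
      (fun x hx hx0 => (ih (by have := finrank_exposedFace_lt (dualCone D) hx0; omega) hC.dual
        (hD.dual.exposedFace x)
        ((h.dual hC hD).symm.exposedFace hC.dual (mem_dd' hx)).symm).resolve_left
          fun h' => hns.1 (h'.of_dualCone hC))
    exact S.not_nuclear T h

theorem Nuclear.isSimplicial_or {V W : Type*}
    [NormedAddCommGroup V] [InnerProductSpace ℝ V] [FiniteDimensional ℝ V]
    [NormedAddCommGroup W] [InnerProductSpace ℝ W] [FiniteDimensional ℝ W]
    {C : Set V} {D : Set W} (hC : IsProperCone C) (hD : IsProperCone D) (h : Nuclear C D) :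
    IsSimplicial C ∨ IsSimplicial D :=
  Nuclear.isSimplicial_or_of_finrank_le _ (Nat.lt_succ_self _) hC hD h

end

section

section StateSpace

variable {E V : Type*} [NormedAddCommGroup E] [NormedSpace ℝ E] [NormedAddCommGroup V]
  [InnerProductSpace ℝ V] [FiniteDimensional ℝ V]

/-- The cone over the image of a set under a linear equivalence. -/
def coneOver (K : Set E) (L : E ≃L[ℝ] V) : Set V := {v | ∃ t : ℝ, 0 ≤ t ∧ ∃ x ∈ L '' K, v = t • x}

omit [FiniteDimensional ℝ V] in
theorem map_mem_coneOver {K : Set E} (L : E ≃L[ℝ] V) {x : E} (hx : x ∈ K) : L x ∈ coneOver K L :=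
  ⟨1, zero_le_one, L x, ⟨x, hx, rfl⟩, by simp⟩

theorem exists_inner_map_eq (L : E ≃L[ℝ] V) (f : E →ₗ[ℝ] ℝ) : ∃ l : V, ∀ x, ⟪l, L x⟫ = f x := by
  obtain ⟨l, hl⟩ := exists_inner_eq (f ∘ₗ L.symm.toLinearEquiv.toLinearMap)
  exact ⟨l, fun x => by simp [hl]⟩

omit [FiniteDimensional ℝ V] in
theorem mem_dualCone_coneOver {K : Set E} {L : E ≃L[ℝ] V} {f : E →ₗ[ℝ] ℝ} {l : V}
    (hl : ∀ x, ⟪l, L x⟫ = f x) (hf : ∀ x ∈ K, 0 ≤ f x) : l ∈ dualCone (coneOver K L) := by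
  rintro _ ⟨t, ht, _, ⟨x, hx, rfl⟩, rfl⟩
  rw [real_inner_smul_right, hl]
  exact mul_nonneg ht (hf x hx)

theorem isProperCone_coneOver {K : Set E} (L : E ≃L[ℝ] V) (hne : K.Nonempty) (hcomp : IsCompact K)
    (hconv : Convex ℝ K) (hspan : Submodule.span ℝ K = ⊤) {e : E →ₗ[ℝ] ℝ}
    (he : ∀ x ∈ K, e x = 1) : IsProperCone (coneOver K L) := by
  obtain ⟨l, hl⟩ := exists_inner_map_eq L e
  exact {
    isClosed := isClosed_cone_over (hcomp.image L.continuous) l (by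
      rintro _ ⟨x, hx, rfl⟩; rw [hl, he x hx])
    zero_mem := by
      obtain ⟨x, hx⟩ := hne
      exact ⟨0, le_rfl, L x, ⟨x, hx, rfl⟩, by simp⟩
    add_mem := by
      rintro _ _ ⟨s, hs, _, ⟨x, hx, rfl⟩, rfl⟩ ⟨t, ht, _, ⟨y, hy, rfl⟩, rfl⟩
      by_cases h0 : s + t = 0
      · have h1 : s = 0 := by linarith
        have h2 : t = 0 := by linarith
        exact ⟨0, le_rfl, L x, ⟨x, hx, rfl⟩, by simp [h1, h2]⟩
      · have hpos : 0 < s + t := lt_of_le_of_ne (by positivity) (Ne.symm h0)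
        refine ⟨s + t, hpos.le, _, ⟨(s / (s + t)) • x + (t / (s + t)) • y,
          hconv hx hy (by positivity) (by positivity) (by field_simp), rfl⟩, ?_⟩
        rw [map_add, map_smul, map_smul, smul_add, smul_smul, smul_smul, mul_div_cancel₀ _ h0,
          mul_div_cancel₀ _ h0]
    smul_mem := by
      rintro c _ hc ⟨t, ht, x, hx, rfl⟩
      exact ⟨c * t, by positivity, x, hx, by rw [smul_smul]⟩
    span_eq_top := by
      rw [eq_top_iff]
      have h1 : Submodule.span ℝ (L.toLinearEquiv.toLinearMap '' K) = ⊤ := by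
        rw [Submodule.span_image, hspan, Submodule.map_top]
        exact L.toLinearEquiv.range
      rw [← h1]
      refine Submodule.span_mono ?_
      rintro _ ⟨x, hx, rfl⟩
      exact map_mem_coneOver L hx
    exists_pos := by
      refine ⟨l, ?_⟩
      rintro _ ⟨t, ht, _, ⟨x, hx, rfl⟩, rfl⟩ h0
      rw [real_inner_smul_right, hl, he x hx, mul_one]
      exact lt_of_le_of_ne ht fun h => h0 (by rw [← h, zero_smul]) }

omit [FiniteDimensional ℝ V] in
theorem linearIndependent_extremePoints {K : Set E} {L : E ≃L[ℝ] V} (hconv : Convex ℝ K)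
    {e : E →ₗ[ℝ] ℝ} (he : ∀ x ∈ K, e x = 1) (h : IsSimplicial (coneOver K L)) :
    LinearIndependent ℝ (Subtype.val : Set.extremePoints ℝ K → E) := by
  classical
  obtain ⟨n, b, hb, hbC⟩ := h
  have hbmem : ∀ i, ∃ s : ℝ, 0 ≤ s ∧ ∃ k ∈ K, b i = s • L k := by
    intro i
    have : b i ∈ coneOver K L := by
      rw [hbC]
      exact ⟨Pi.single i 1, fun j => by by_cases h : j = i <;> simp [h],
        by simp [Pi.single_apply]⟩
    obtain ⟨s, hs, _, ⟨k, hk, rfl⟩, h⟩ := this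
    exact ⟨s, hs, k, hk, h⟩
  choose s hs k hk hbk using hbmem
  have hli : LinearIndependent ℝ k := by
    rw [Fintype.linearIndependent_iff] at hb ⊢
    intro c hc i
    have hs0 : ∀ i, s i ≠ 0 := fun i h0 => by
      have := hb (Pi.single i 1) (by simp [Pi.single_apply, hbk, h0]) i
      simp at this
    have := hb (fun i => c i * (s i)⁻¹) (by
      simp only [hbk, smul_smul, inv_mul_cancel_right₀ (hs0 _)]
      simpa using congrArg L hc) i
    simpa [hs0 i] using this
  have hKk : K = convexHull ℝ (Set.range k) := by
    refine Set.Subset.antisymm (fun x hx => ?_)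
      (convexHull_min (by rintro _ ⟨i, rfl⟩; exact hk i) hconv)
    have := map_mem_coneOver L hx
    rw [hbC] at this
    obtain ⟨c, hc, hxc⟩ := this
    have hx' : x = ∑ i, (c i * s i) • k i := by
      apply L.injective
      rw [hxc, map_sum]
      exact Finset.sum_congr rfl fun i _ => by rw [hbk, map_smul, smul_smul]
    have hsum : ∑ i, c i * s i = 1 := by
      have := he x hx
      rw [hx', map_sum] at this
      simpa [he _ (hk _)] using this
    rw [hx']
    exact (convex_convexHull ℝ _).sum_mem (fun i _ => mul_nonneg (hc i) (hs i)) hsum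
      fun i _ => subset_convexHull ℝ _ ⟨i, rfl⟩
  have hsub : Set.extremePoints ℝ K ⊆ Set.range k := by
    rw [hKk]; exact extremePoints_convexHull_subset
  exact LinearIndepOn.mono hli.linearIndepOn_id hsub

end StateSpace

section Functional

variable {E F : Type*} [AddCommGroup E] [Module ℝ E] [AddCommGroup F] [Module ℝ F]

@[simp]
theorem tensorFunctional_tmul (f : E →ₗ[ℝ] ℝ) (g : F →ₗ[ℝ] ℝ) (x : E) (y : F) :
    tensorFunctional f g (x ⊗ₜ y) = f x * g y := by
  simp [tensorFunctional]

theorem tensorFunctional_comm (f : E →ₗ[ℝ] ℝ) (g : F →ₗ[ℝ] ℝ) (z : E ⊗[ℝ] F) :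
    tensorFunctional g f (TensorProduct.comm ℝ E F z) = tensorFunctional f g z := by
  induction z with
  | zero => simp
  | tmul x y => simp [mul_comm]
  | add x y hx hy => simp [hx, hy]

theorem comm_mem_maxTensor {K : Set E} {L : Set F} {e : E →ₗ[ℝ] ℝ} {d : F →ₗ[ℝ] ℝ}
    {z : E ⊗[ℝ] F} (hz : z ∈ maxTensor K L e d) :
    TensorProduct.comm ℝ E F z ∈ maxTensor L K d e :=
  ⟨fun g f hg hf => by rw [tensorFunctional_comm]; exact hz.1 f g hf hg,
    by rw [tensorFunctional_comm]; exact hz.2⟩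

theorem comm_mem_minTensor {K : Set E} {L : Set F} {z : E ⊗[ℝ] F} (hz : z ∈ minTensor K L) :
    TensorProduct.comm ℝ E F z ∈ minTensor L K := by
  have : minTensor K L ⊆ (TensorProduct.comm ℝ E F).toLinearMap ⁻¹' minTensor L K := by
    refine convexHull_min ?_ ((convex_convexHull ℝ _).linear_preimage _)
    rintro _ ⟨x, hx, y, hy, rfl⟩
    exact subset_convexHull ℝ _ ⟨y, hy, x, hx, by simp⟩
  exact this hz

theorem minTensor_subset_maxTensor {K : Set E} {L : Set F} {e : E →ₗ[ℝ] ℝ} {d : F →ₗ[ℝ] ℝ}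
    (he : ∀ x ∈ K, e x = 1) (hd : ∀ y ∈ L, d y = 1) : minTensor K L ⊆ maxTensor K L e d := by
  refine fun z hz => ⟨fun f g hf hg => ?_, ?_⟩
  · have : minTensor K L ⊆ tensorFunctional f g ⁻¹' Set.Ici 0 := by
      refine convexHull_min ?_ ((convex_Ici 0).linear_preimage _)
      rintro _ ⟨x, hx, y, hy, rfl⟩
      simpa using mul_nonneg (hf x hx).1 (hg y hy).1
    exact this hz
  · have : minTensor K L ⊆ tensorFunctional e d ⁻¹' {1} := by
      refine convexHull_min ?_ ((convex_singleton 1).linear_preimage _)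
      rintro _ ⟨x, hx, y, hy, rfl⟩
      simp [he x hx, hd y hy]
    exact this hz

/-- Contraction of the first tensor factor with a functional. -/
noncomputable def contractLeft (f : E →ₗ[ℝ] ℝ) : E ⊗[ℝ] F →ₗ[ℝ] F :=
  (TensorProduct.lid ℝ F).toLinearMap ∘ₗ f.rTensor F

@[simp]
theorem contractLeft_tmul (f : E →ₗ[ℝ] ℝ) (x : E) (y : F) :
    contractLeft f (x ⊗ₜ[ℝ] y) = f x • y := by
  simp [contractLeft]

theorem tensorFunctional_eq_contractLeft (f : E →ₗ[ℝ] ℝ) (g : F →ₗ[ℝ] ℝ) (z : E ⊗[ℝ] F) :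
    tensorFunctional f g z = g (contractLeft f z) := by
  induction z with
  | zero => simp
  | tmul x y => simp
  | add x y hx hy => simp [hx, hy]

theorem eq_sum_tmul_contractLeft {ι : Type*} [Fintype ι] (b : Module.Basis ι ℝ E) (z : E ⊗[ℝ] F) :
    z = ∑ i, b i ⊗ₜ contractLeft (b.coord i) z := by
  induction z with
  | zero => simp
  | tmul x y =>
    simp only [contractLeft_tmul, TensorProduct.tmul_smul, TensorProduct.smul_tmul',
      ← TensorProduct.sum_tmul]
    congr 1
    simp
  | add x y hx hy =>
    simp only [map_add, TensorProduct.tmul_add, Finset.sum_add_distrib]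
    rw [← hx, ← hy]

end Functional

variable {E F : Type*} [NormedAddCommGroup E] [NormedSpace ℝ E] [FiniteDimensional ℝ E]
  [NormedAddCommGroup F] [NormedSpace ℝ F] [FiniteDimensional ℝ F]
  {K : Set E} {L : Set F} {e : E →ₗ[ℝ] ℝ} {d : F →ₗ[ℝ] ℝ}

theorem exists_eq_smul_of_forall_effect (hne : L.Nonempty) (hcomp : IsCompact L)
    (hconv : Convex ℝ L) (hspan : Submodule.span ℝ L = ⊤) (hd : ∀ y ∈ L, d y = 1) {y : F}
    (h : ∀ g : F →ₗ[ℝ] ℝ, (∀ y ∈ L, 0 ≤ g y ∧ g y ≤ 1) → 0 ≤ g y) :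
    ∃ t : ℝ, 0 ≤ t ∧ ∃ k ∈ L, y = t • k := by
  let M : F ≃L[ℝ] EuclideanSpace ℝ (Fin (Module.finrank ℝ F)) := toEuclidean
  have hy : M y ∈ coneOver L M := by
    refine (isProperCone_coneOver M hne hcomp hconv hspan hd).mem_of_dual fun f hf => ?_
    let g : F →ₗ[ℝ] ℝ := innerₗ _ f ∘ₗ M.toLinearEquiv.toLinearMap
    obtain ⟨B, hB⟩ := (hcomp.image (f := g) g.continuous_of_finiteDimensional).bddAbove
    have hBg : ∀ y ∈ L, g y ≤ max B 1 := fun y hy => (hB ⟨y, hy, rfl⟩).trans (le_max_left _ _)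
    have hpos : 0 < max B 1 := lt_max_of_lt_right one_pos
    have := h ((max B 1)⁻¹ • g) fun y hy =>
      ⟨mul_nonneg (by positivity) (hf _ (map_mem_coneOver M hy)), by
        change (max B 1)⁻¹ * g y ≤ 1
        rw [inv_mul_le_iff₀ hpos, mul_one]; exact hBg y hy⟩
    exact nonneg_of_mul_nonneg_right this (by positivity)
  obtain ⟨t, ht, _, ⟨k, hk, rfl⟩, h⟩ := hy
  exact ⟨t, ht, k, hk, M.injective (by rw [h, map_smul])⟩

theorem maxTensor_subset_minTensor (hcompK : IsCompact K) (hconvK : Convex ℝ K)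
    (hspanK : Submodule.span ℝ K = ⊤) (he : ∀ x ∈ K, e x = 1)
    (hne : L.Nonempty) (hcomp : IsCompact L)
    (hconv : Convex ℝ L) (hspan : Submodule.span ℝ L = ⊤) (hd : ∀ y ∈ L, d y = 1)
    (hli : LinearIndependent ℝ (Subtype.val : Set.extremePoints ℝ K → E)) :
    maxTensor K L e d ⊆ minTensor K L := by
  intro z hz
  have hfin : (Set.extremePoints ℝ K).Finite := hli.setFinite
  have hK : K = convexHull ℝ (Set.extremePoints ℝ K) := by
    have hclosed : IsClosed (convexHull ℝ (Set.extremePoints ℝ K)) := hfin.isClosed_convexHull ℝ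
    rw [← hclosed.closure_eq, closure_convexHull_extremePoints hcompK hconvK]
  have := hfin.fintype
  have htop : ⊤ ≤ Submodule.span ℝ (Set.range (Subtype.val : Set.extremePoints ℝ K → E)) := by
    rw [Subtype.range_coe, ← hspanK, Submodule.span_le]
    conv_lhs => rw [hK]
    exact convexHull_min Submodule.subset_span (Submodule.convex _)
  let b := Module.Basis.mk hli htop
  have hb : ∀ i, b i = i := fun i => by simp [b]
  have hbK : ∀ i, b i ∈ K := fun i => by rw [hb]; exact extremePoints_subset i.2
  have hcoord : ∀ i, ∀ x ∈ K, 0 ≤ b.coord i x ∧ b.coord i x ≤ 1 := by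
    classical
    intro i
    have : K ⊆ b.coord i ⁻¹' Set.Icc 0 1 := by
      conv_lhs => rw [hK]
      refine convexHull_min (fun x hx => ?_) ((convex_Icc 0 1).linear_preimage _)
      have hx' : x = b ⟨x, hx⟩ := (hb ⟨x, hx⟩).symm
      rw [hx']
      simp only [Set.mem_preimage, Module.Basis.coord_apply, Module.Basis.repr_self,
        Finsupp.single_apply]
      split_ifs <;> simp
    exact this
  have hy : ∀ i, ∃ t : ℝ, 0 ≤ t ∧ ∃ k ∈ L, contractLeft (b.coord i) z = t • k := fun i =>
    exists_eq_smul_of_forall_effect hne hcomp hconv hspan hd fun g hg => by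
      rw [← tensorFunctional_eq_contractLeft]
      exact hz.1 _ _ (hcoord i) hg
  choose t ht k hk hy using hy
  have hzsum : z = ∑ i, t i • (b i ⊗ₜ[ℝ] k i) := by
    conv_lhs => rw [eq_sum_tmul_contractLeft b z]
    exact Finset.sum_congr rfl fun i _ => by rw [hy, TensorProduct.tmul_smul]
  have hsum : ∑ i, t i = 1 := by
    have := hz.2
    rw [hzsum, map_sum] at this
    simpa [he _ (hbK _), hd _ (hk _)] using this
  rw [hzsum]
  exact (convex_convexHull ℝ _).sum_mem (fun i _ => ht i) hsum
    fun i _ => subset_convexHull ℝ _ ⟨b i, hbK i, k i, hk i, rfl⟩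

omit [FiniteDimensional ℝ E] [FiniteDimensional ℝ F] in
theorem nuclear_coneOver {V W : Type*} [NormedAddCommGroup V] [InnerProductSpace ℝ V]
    [FiniteDimensional ℝ V] [NormedAddCommGroup W] [InnerProductSpace ℝ W] [FiniteDimensional ℝ W]
    (P : E ≃L[ℝ] V) (Q : F ≃L[ℝ] W)
    (hneK : K.Nonempty) (hneL : L.Nonempty) (hP : IsProperCone (coneOver K P))
    (hQ : IsProperCone (coneOver L Q)) (he : ∀ x ∈ K, e x = 1) (hd : ∀ y ∈ L, d y = 1)
    (h : maxTensor K L e d ⊆ minTensor K L) : Nuclear (coneOver K P) (coneOver L Q) := by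
  let T : E ⊗[ℝ] F ≃ₗ[ℝ] V ⊗[ℝ] W := TensorProduct.congr P.toLinearEquiv Q.toLinearEquiv
  have hT : ∀ x y, T (x ⊗ₜ y) = P x ⊗ₜ Q y := fun x y => by simp [T]
  have hmin : ∀ z ∈ minTensor K L, T z ∈ sepCone (coneOver K P) (coneOver L Q) := by
    intro z hz
    have hconv : Convex ℝ (sepCone (coneOver K P) (coneOver L Q) : Set (V ⊗[ℝ] W)) :=
      fun x hx y hy a b ha hb _ => add_mem (smul_mem_hull ha hx) (smul_mem_hull hb hy)
    have : minTensor K L ⊆ T.toLinearMap ⁻¹' sepCone (coneOver K P) (coneOver L Q) := by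
      refine convexHull_min ?_ (hconv.linear_preimage _)
      rintro _ ⟨x, hx, y, hy, rfl⟩
      change T (x ⊗ₜ y) ∈ sepCone _ _
      rw [hT]
      exact tmul_mem_sepCone (map_mem_coneOver P hx) (map_mem_coneOver Q hy)
    exact this hz
  intro ω hω
  obtain ⟨x₀, hx₀⟩ := hneK
  obtain ⟨y₀, hy₀⟩ := hneL
  have hpos : ∀ (f : E →ₗ[ℝ] ℝ) (g : F →ₗ[ℝ] ℝ), (∀ x ∈ K, 0 ≤ f x) → (∀ y ∈ L, 0 ≤ g y) →
      0 ≤ tensorFunctional f g (T.symm ω) := by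
    intro f g hf hg
    obtain ⟨l, hl⟩ := exists_inner_map_eq P f
    obtain ⟨m, hm⟩ := exists_inner_map_eq Q g
    have key : ∀ z, ⟪T z, l ⊗ₜ[ℝ] m⟫ = tensorFunctional f g z := by
      intro z
      induction z with
      | zero => rw [map_zero, map_zero, inner_zero_left_tensor]
      | tmul x y =>
        rw [hT, TensorProduct.inner_tmul, tensorFunctional_tmul, real_inner_comm, hl,
          real_inner_comm, hm]
      | add x y hx hy => rw [map_add, map_add, inner_add_left_tensor, hx, hy]
    rw [← key, T.apply_symm_apply]
    exact hω _ (mem_dualCone_coneOver hl hf) _ (mem_dualCone_coneOver hm hg)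
  have happrox : ∀ ε : ℝ, 0 < ε →
      ω + ε • (P x₀ ⊗ₜ[ℝ] Q y₀) ∈ sepCone (coneOver K P) (coneOver L Q) := by
    intro ε hε
    set t := tensorFunctional e d (T.symm ω) with ht
    have ht0 : 0 ≤ t := hpos e d (fun x hx => by rw [he x hx]; norm_num)
      fun y hy => by rw [hd y hy]; norm_num
    have hmem : (t + ε)⁻¹ • (T.symm ω + ε • (x₀ ⊗ₜ[ℝ] y₀)) ∈ maxTensor K L e d := by
      refine ⟨fun f g hf hg => ?_, ?_⟩
      · rw [map_smul, map_add, map_smul, tensorFunctional_tmul]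
        have h1 := hpos f g (fun x hx => (hf x hx).1) fun y hy => (hg y hy).1
        have h2 := mul_nonneg (hf x₀ hx₀).1 (hg y₀ hy₀).1
        simp only [smul_eq_mul]
        positivity
      · rw [map_smul, map_add, map_smul, tensorFunctional_tmul, he x₀ hx₀, hd y₀ hy₀, ← ht]
        simp only [smul_eq_mul]
        field_simp
    have h1 := smul_mem_hull (c := t + ε) (by positivity) (hmin _ (h hmem))
    have h2 : (t + ε) • T ((t + ε)⁻¹ • (T.symm ω + ε • (x₀ ⊗ₜ[ℝ] y₀))) =
        ω + ε • (P x₀ ⊗ₜ[ℝ] Q y₀) := by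
      rw [map_smul, smul_inv_smul₀ (by positivity), map_add, map_smul, hT, T.apply_symm_apply]
    rwa [h2] at h1
  have hlim : Filter.Tendsto (fun ε : ℝ => ω + ε • (P x₀ ⊗ₜ[ℝ] Q y₀)) (nhdsWithin 0 (Set.Ioi 0))
      (nhds ω) := by
    have : Continuous fun ε : ℝ => ω + ε • (P x₀ ⊗ₜ[ℝ] Q y₀) := by fun_prop
    have h0 := this.tendsto 0
    simp only [zero_smul, add_zero] at h0
    exact h0.mono_left nhdsWithin_le_nhds
  exact (isClosedCone_sepCone hP hQ).isClosed.mem_of_tendsto hlim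
    (eventually_nhdsWithin_of_forall fun ε hε => happrox ε hε)

end

end ConeTensor

/-- the minimal and maximal tensor products coincide if and only if one
of the factors is a simplex, i.e., its set of extreme points is linearly
independent. -/
theorem minTensor_eq_maxTensor_iff_simplex
    {VA VB : Type*} [NormedAddCommGroup VA] [NormedSpace ℝ VA] [FiniteDimensional ℝ VA]
    [NormedAddCommGroup VB] [NormedSpace ℝ VB] [FiniteDimensional ℝ VB]
    (KA : Set VA) (KB : Set VB)
    (hneA : KA.Nonempty) (hcompA : IsCompact KA) (hconvA : Convex ℝ KA)
    (hneB : KB.Nonempty) (hcompB : IsCompact KB) (hconvB : Convex ℝ KB)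
    (hspanA : Submodule.span ℝ KA = ⊤) (hspanB : Submodule.span ℝ KB = ⊤)
    (eA : VA →ₗ[ℝ] ℝ) (eB : VB →ₗ[ℝ] ℝ)
    (heA : ∀ x ∈ KA, eA x = 1) (heB : ∀ y ∈ KB, eB y = 1) :
    minTensor KA KB = maxTensor KA KB eA eB ↔
      (LinearIndependent ℝ (Subtype.val : Set.extremePoints ℝ KA → VA) ∨
       LinearIndependent ℝ (Subtype.val : Set.extremePoints ℝ KB → VB)) := by
  constructor
  · intro h
    let P : VA ≃L[ℝ] EuclideanSpace ℝ (Fin (Module.finrank ℝ VA)) := toEuclidean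
    let Q : VB ≃L[ℝ] EuclideanSpace ℝ (Fin (Module.finrank ℝ VB)) := toEuclidean
    have hP := ConeTensor.isProperCone_coneOver P hneA hcompA hconvA hspanA heA
    have hQ := ConeTensor.isProperCone_coneOver Q hneB hcompB hconvB hspanB heB
    exact ((ConeTensor.nuclear_coneOver P Q hneA hneB hP hQ heA heB h.ge).isSimplicial_or hP hQ).imp
      (ConeTensor.linearIndependent_extremePoints hconvA heA)
      (ConeTensor.linearIndependent_extremePoints hconvB heB)
  · intro h
    refine (ConeTensor.minTensor_subset_maxTensor heA heB).antisymm fun z hz => ?_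
    obtain h | h := h
    · exact ConeTensor.maxTensor_subset_minTensor hcompA hconvA hspanA heA hneB hcompB hconvB
        hspanB heB h hz
    · have := ConeTensor.comm_mem_minTensor (ConeTensor.maxTensor_subset_minTensor hcompB hconvB
        hspanB heB hneA hcompA hconvA hspanA heA h (ConeTensor.comm_mem_maxTensor hz))
      simpa using this
end

section
/- Existence of incompatible two-outcome measurements characterizes non-classicality: let V be a finite-dimensional real normed vector space and K ⊆ V a nonempty compact convex set. Call two effects f, g on K compatible if there exists an affine function h : V → ℝ such that for all x ∈ K: 0 ≤ h(x), h(x) ≤ f(x), h(x) ≤ g(x), and f(x) + g(x) − h(x) ≤ 1. Then every pair of effects on K is compatible if and only if the set of extreme points of K is affinely independent (i.e., if and only if K is a simplex). -/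
namespace JointEffects

section FunctionSpace

variable {X : Type*} [TopologicalSpace X]

/-- Any two effects in a space `A` of continuous functions admit a joint effect in `A`. -/
def Compatible (A : Submodule ℝ C(X, ℝ)) : Prop :=
  ∀ f ∈ A, ∀ g ∈ A, (∀ x, 0 ≤ f x ∧ f x ≤ 1) → (∀ x, 0 ≤ g x ∧ g x ≤ 1) →
    ∃ h ∈ A, ∀ x, 0 ≤ h x ∧ h x ≤ f x ∧ h x ≤ g x ∧ f x + g x - h x ≤ 1

theorem Compatible.exists_joint_of_le {A : Submodule ℝ C(X, ℝ)} (hA : Compatible A)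
    {f g : C(X, ℝ)} (hf : f ∈ A) (hg : g ∈ A) (hf1 : ∀ x, 0 ≤ f x ∧ f x ≤ 1) {M : ℝ}
    (hM : 0 < M) (hgM : ∀ x, 0 ≤ g x ∧ g x ≤ M) :
    ∃ h ∈ A, ∀ x, 0 ≤ h x ∧ h x ≤ M * f x ∧ h x ≤ g x ∧ g x - h x ≤ M * (1 - f x) := by
  obtain ⟨h, hhA, hh⟩ := hA f hf (M⁻¹ • g) (A.smul_mem _ hg) hf1 (fun x => by
    have := hgM x
    simp only [ContinuousMap.smul_apply, smul_eq_mul]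
    refine ⟨mul_nonneg (inv_nonneg.2 hM.le) this.1, ?_⟩
    rw [inv_mul_le_iff₀ hM]; linarith)
  refine ⟨M • h, A.smul_mem _ hhA, fun x => ?_⟩
  obtain ⟨h0, h1, h2, h3⟩ := hh x
  simp only [ContinuousMap.smul_apply, smul_eq_mul] at *
  have e : g x = M * (M⁻¹ * g x) := by field_simp
  refine ⟨by positivity, by gcongr, ?_, ?_⟩
  · rw [e]; gcongr
  · rw [e]; nlinarith

theorem isClosed_eval_bounds (a b : X → ℝ) :
    IsClosed {u : C(X, ℝ) | ∀ x, a x ≤ u x ∧ u x ≤ b x} := by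
  have hc (x : X) : Continuous fun u : C(X, ℝ) => u x := continuous_eval_const x
  simp only [Set.ofPred_forall]
  exact isClosed_iInter fun x =>
    (isClosed_le continuous_const (hc x)).inter (isClosed_le (hc x) continuous_const)

variable [CompactSpace X]

theorem isCompact_inter_closedBall (A : Submodule ℝ C(X, ℝ)) [FiniteDimensional ℝ A] (r : ℝ) :
    IsCompact ((A : Set C(X, ℝ)) ∩ Metric.closedBall 0 r) := by
  have := (isCompact_closedBall (0 : A) r).image (continuous_subtype_val (p := (· ∈ A)))
  convert this using 1
  ext u
  simp [and_comm]

theorem isCompact_of_forall_bounds (A : Submodule ℝ C(X, ℝ)) [FiniteDimensional ℝ A]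
    {S : Set C(X, ℝ)} (hS : IsClosed S) (hSA : S ⊆ A) {r : ℝ} (hr : 0 ≤ r)
    (hb : ∀ u ∈ S, ∀ x, 0 ≤ u x ∧ u x ≤ r) : IsCompact S := by
  refine (isCompact_inter_closedBall A r).of_isClosed_subset hS fun u hu => ⟨hSA hu, ?_⟩
  rw [mem_closedBall_zero_iff, ContinuousMap.norm_le _ hr]
  intro x
  rw [Real.norm_eq_abs, abs_of_nonneg (hb u hu x).1]
  exact (hb u hu x).2

/-- In the presence of joint effects, the effects with value `1` at `p` have a least element. -/
theorem Compatible.exists_least_effect {A : Submodule ℝ C(X, ℝ)} [FiniteDimensional ℝ A]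
    (hA : Compatible A) (h1 : (1 : C(X, ℝ)) ∈ A) (p : X) :
    ∃ u ∈ A, (∀ x, 0 ≤ u x ∧ u x ≤ 1) ∧ u p = 1 ∧
      ∀ v ∈ A, (∀ x, 0 ≤ v x ∧ v x ≤ 1) → v p = 1 → ∀ x, u x ≤ v x := by
  let H : Set C(X, ℝ) := {u | u ∈ A ∧ (∀ x, 0 ≤ u x ∧ u x ≤ 1) ∧ u p = 1}
  let t : H → Set C(X, ℝ) := fun v => {u | u ∈ H ∧ ∀ x, u x ≤ v.1 x}
  have : Nonempty H := ⟨⟨1, h1, fun x => by simp, by simp⟩⟩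
  have hAc : IsClosed (A : Set C(X, ℝ)) := A.closed_of_finiteDimensional
  have hHc : IsClosed H := by
    exact hAc.inter ((isClosed_eval_bounds 0 1).inter
      (isClosed_eq (continuous_eval_const p) continuous_const))
  have htc : ∀ v, IsClosed (t v) := by
    intro v
    refine hHc.inter (?_ : IsClosed {u : C(X, ℝ) | ∀ x, u x ≤ v.1 x})
    simp only [Set.ofPred_forall]
    exact isClosed_iInter fun x => isClosed_le (continuous_eval_const x) continuous_const
  have hne := IsCompact.nonempty_iInter_of_directed_nonempty_isCompact_isClosed t ?_
    (fun v => ⟨v, v.2, fun x => le_rfl⟩)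
    (fun v => isCompact_of_forall_bounds A (htc v) (fun u hu => hu.1.1) zero_le_one
      fun u hu => hu.1.2.1) htc
  · obtain ⟨u, hu⟩ := hne
    rw [Set.mem_iInter] at hu
    obtain ⟨a, b, c⟩ := (hu (Classical.arbitrary H)).1
    exact ⟨u, a, b, c, fun v hvA hv hvp => (hu ⟨v, hvA, hv, hvp⟩).2⟩
  · rintro ⟨v, hvA, hv, hvp⟩ ⟨w, hwA, hw, hwp⟩
    obtain ⟨h, hhA, hh⟩ := hA v hvA w hwA hv hw
    refine ⟨⟨h, hhA, fun x => ⟨(hh x).1, (hh x).2.1.trans (hv x).2⟩, ?_⟩, ?_, ?_⟩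
    · have := hh p
      rw [hvp, hwp] at this
      linarith [this.2.1, this.2.2.2]
    · exact fun u hu => ⟨hu.1, fun x => (hu.2 x).trans (hh x).2.1⟩
    · exact fun u hu => ⟨hu.1, fun x => (hu.2 x).trans (hh x).2.2.1⟩

/-- If `p` is exposed by a function in `A`, there is an effect with value `1` exactly at `p`
whose multiple by `g p` lies below any nonnegative `g` in `A`. -/
theorem Compatible.exists_peak {A : Submodule ℝ C(X, ℝ)} [FiniteDimensional ℝ A]
    (hA : Compatible A) (h1 : (1 : C(X, ℝ)) ∈ A) {p : X} {φ : C(X, ℝ)} (hφ : φ ∈ A)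
    (hφp : ∀ x, x ≠ p → φ x < φ p) :
    ∃ u ∈ A, (∀ x, 0 ≤ u x) ∧ u p = 1 ∧ (∀ x, x ≠ p → u x < 1) ∧
      ∀ g ∈ A, (∀ x, 0 ≤ g x) → ∀ x, g p * u x ≤ g x := by
  obtain ⟨u, huA, hu, hup, hmin⟩ := hA.exists_least_effect h1 p
  have hpeak : ∀ x, x ≠ p → u x < 1 := by
    set ψ : C(X, ℝ) := φ p • (1 : C(X, ℝ)) - φ with hψ
    have hψA : ψ ∈ A := A.sub_mem (A.smul_mem _ h1) hφ
    have hψx : ∀ x, ψ x = φ p - φ x := fun x => by simp [hψ]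
    have hle : ∀ x, ψ x ≤ ‖ψ‖ := fun x => (le_abs_self _).trans (ψ.norm_coe_le_norm x)
    have hr : 0 < ‖ψ‖ + 1 := by positivity
    have hval : ∀ x, ((1 : C(X, ℝ)) - (‖ψ‖ + 1)⁻¹ • ψ) x = 1 - (‖ψ‖ + 1)⁻¹ * (φ p - φ x) :=
      fun x => by simp [hψx]
    intro x hx
    have := hmin (1 - (‖ψ‖ + 1)⁻¹ • ψ) (A.sub_mem h1 (A.smul_mem _ hψA)) (fun y => by
      rw [hval]
      have h0 : 0 ≤ φ p - φ y := by
        by_cases hy : y = p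
        · simp [hy]
        · linarith [hφp y hy]
      have h2 : (‖ψ‖ + 1)⁻¹ * (φ p - φ y) ≤ 1 := by
        rw [inv_mul_le_iff₀ hr]; linarith [hle y, hψx y]
      have h3 : 0 ≤ (‖ψ‖ + 1)⁻¹ * (φ p - φ y) := by positivity
      constructor <;> linarith) (by rw [hval]; simp) x
    rw [hval] at this
    have h3 : 0 < (‖ψ‖ + 1)⁻¹ * (φ p - φ x) := mul_pos (by positivity) (by linarith [hφp x hx])
    linarith
  refine ⟨u, huA, fun x => (hu x).1, hup, hpeak, fun g hgA hg x => ?_⟩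
  rcases (hg p).eq_or_lt with h0 | hgp
  · rw [← h0, zero_mul]; exact hg x
  let S : Set C(X, ℝ) := {h | h ∈ A ∧ (∀ y, 0 ≤ h y ∧ h y ≤ g y) ∧ h p = g p}
  have hSc : IsCompact S := by
    refine isCompact_of_forall_bounds A ?_ (fun v hv => hv.1) (norm_nonneg g) fun v hv y =>
      ⟨(hv.2.1 y).1, (hv.2.1 y).2.trans ((le_abs_self _).trans (g.norm_coe_le_norm y))⟩
    exact A.closed_of_finiteDimensional.inter ((isClosed_eval_bounds 0 g).inter
      (isClosed_eq (continuous_eval_const p) continuous_const))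
  obtain ⟨h, hhS, hmn⟩ := hSc.exists_isMinOn ⟨g, hgA, fun y => ⟨hg y, le_rfl⟩, rfl⟩
    continuous_norm.continuousOn
  obtain ⟨hhA, hhb, hhp⟩ := hhS
  have hle : ∀ y, h y ≤ ‖h‖ := fun y => (le_abs_self _).trans (h.norm_coe_le_norm y)
  have hpos : 0 < ‖h‖ := by linarith [hle p]
  obtain ⟨k, hkA, hk⟩ := hA.exists_joint_of_le huA hhA hu hpos fun y => ⟨(hhb y).1, hle y⟩
  have hkp : k p = g p := by
    have := hk p
    rw [hup, hhp] at this
    linarith [this.2.2.1, this.2.2.2]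
  have hkS : k ∈ S := ⟨hkA, fun y => ⟨(hk y).1, (hk y).2.2.1.trans (hhb y).2⟩, hkp⟩
  have hnorm : ‖h‖ ≤ ‖k‖ := hmn hkS
  have : Nonempty X := ⟨p⟩
  obtain ⟨e, -, he⟩ := isCompact_univ.exists_isMaxOn (Set.univ_nonempty (α := X))
    k.continuous.continuousOn
  have hemax : ∀ y, k y ≤ k e := fun y => he (Set.mem_univ y)
  have hke : ‖k‖ ≤ k e := by
    rw [ContinuousMap.norm_le _ (hk e).1]
    intro y
    rw [Real.norm_eq_abs, abs_of_nonneg (hk y).1]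
    exact hemax y
  have hep : e = p := by
    by_contra hne
    have := mul_lt_mul_of_pos_left (hpeak e hne) hpos
    linarith [(hk e).2.1]
  subst hep
  have hfin := hmin ((g e)⁻¹ • k) (A.smul_mem _ hkA) (fun y => by
    simp only [ContinuousMap.smul_apply, smul_eq_mul]
    refine ⟨mul_nonneg (by positivity) (hk y).1, ?_⟩
    rw [inv_mul_le_iff₀ hgp]
    linarith [hemax y]) (by simp [hkp, hgp.ne']) x
  simp only [ContinuousMap.smul_apply, smul_eq_mul] at hfin
  rw [le_inv_mul_iff₀ hgp] at hfin
  exact hfin.trans (((hk x).2.2.1).trans (hhb x).2)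

end FunctionSpace

section Convex

variable {V : Type*} [NormedAddCommGroup V] [NormedSpace ℝ V]

/-- The affine function `f` attains its maximum over `K` exactly at `p`. -/
def Exposes (K : Set V) (f : V →ᵃ[ℝ] ℝ) (p : V) : Prop :=
  p ∈ K ∧ ∀ x ∈ K, x ≠ p → f x < f p

theorem affineIndependent_of_dual {S : Set V}
    (h : ∀ p ∈ S, ∃ u : V →ᵃ[ℝ] ℝ, u p = 1 ∧ ∀ q ∈ S, q ≠ p → u q = 0) :
    AffineIndependent ℝ (Subtype.val : S → V) := by
  rw [affineIndependent_iff]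
  intro s w hw hwp i hi
  obtain ⟨u, hup, huq⟩ := h i i.2
  have hu : ∀ x, u x = u.linear x + u 0 := fun x => congrFun u.decomp x
  have h1 : ∑ j ∈ s, w j * u j = 0 := by
    rw [Finset.sum_congr rfl fun j _ => congrArg (w j * ·) (hu j)]
    simp only [mul_add, Finset.sum_add_distrib, ← Finset.sum_mul, hw, zero_mul, add_zero]
    have := congrArg u.linear hwp
    simpa only [map_sum, map_zero, map_smul, smul_eq_mul] using this
  rw [Finset.sum_eq_single i] at h1
  · simpa [hup] using h1
  · intro j _ hj
    rw [huq j j.2 (fun h => hj (Subtype.ext h)), mul_zero]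
  · exact fun h => absurd hi h

theorem Exposes.mem_extremePoints {K : Set V} {φ : V →ᵃ[ℝ] ℝ} {p : V} (hp : Exposes K φ p) :
    p ∈ K.extremePoints ℝ := by
  refine ⟨hp.1, fun x hx y hy ⟨a, b, ha, hb, hab, hxy⟩ => ?_⟩
  have hle : ∀ w ∈ K, φ w ≤ φ p := fun w hw => by
    by_cases h : w = p
    · rw [h]
    · exact (hp.2 w hw h).le
  by_contra hne
  have h1 := hp.2 x hx hne
  have h2 := hle y hy
  have h3 : φ p = a * φ x + b * φ y := by
    rw [← hxy, Convex.combo_affine_apply hab]; simp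
  have : φ p = a * φ p + b * φ p := by rw [← add_mul, hab, one_mul]
  nlinarith

variable [FiniteDimensional ℝ V]

/-- An affine function that is positive somewhere on a compact set is positive at an exposed
point. -/
theorem exists_exposed_pos {K : Set V} (hK : IsCompact K) (g : V →ᵃ[ℝ] ℝ) {x : V} (hx : x ∈ K)
    (hgx : 0 < g x) : ∃ p f, Exposes K f p ∧ 0 < g p := by
  let T := toEuclidean (E := V)
  have hTc : Continuous fun y => ‖T y‖ ^ 2 := (T.continuous.norm).pow 2
  have hgc : Continuous g := g.continuous_of_finiteDimensional
  obtain ⟨m, hm, hmax⟩ := hK.exists_isMaxOn ⟨x, hx⟩ hTc.continuousOn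
  let ε := g x / (2 * (‖T m‖ ^ 2 + 1))
  have hε : 0 < ε := by positivity
  have hεm : ε * ‖T m‖ ^ 2 < g x := by
    have : ε * (2 * (‖T m‖ ^ 2 + 1)) = g x := by simp only [ε]; field_simp
    nlinarith [sq_nonneg ‖T m‖]
  obtain ⟨p, hp, hpmax⟩ := hK.exists_isMaxOn ⟨x, hx⟩
    (hgc.add (continuous_const.mul hTc) : Continuous fun y => g y + ε * ‖T y‖ ^ 2).continuousOn
  have hpm : ∀ y ∈ K, g y + ε * ‖T y‖ ^ 2 ≤ g p + ε * ‖T p‖ ^ 2 := fun y hy => hpmax hy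
  have hmm : ∀ y ∈ K, ‖T y‖ ^ 2 ≤ ‖T m‖ ^ 2 := fun y hy => hmax hy
  let L : V →ₗ[ℝ] ℝ := (innerSL ℝ (T p)).toLinearMap ∘ₗ T.toLinearEquiv.toLinearMap
  have hL : ∀ y, L y = inner ℝ (T p) (T y) := fun y => rfl
  refine ⟨p, g + (2 * ε) • L.toAffineMap, ⟨hp, fun y hy hyp => ?_⟩, ?_⟩
  · have h1 : 0 < ‖T p - T y‖ ^ 2 := by
      have : T p - T y ≠ 0 := sub_ne_zero.2 fun h => hyp (T.injective h).symm
      positivity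
    rw [norm_sub_sq_real] at h1
    have h2 := hpm y hy
    simp only [AffineMap.coe_add, AffineMap.coe_smul, Pi.add_apply, Pi.smul_apply,
      LinearMap.coe_toAffineMap, smul_eq_mul, hL, real_inner_self_eq_norm_sq]
    nlinarith
  · have h1 := hpm x hx
    have h2 := mul_le_mul_of_nonneg_left (hmm p hp) hε.le
    have h3 : 0 ≤ ε * ‖T x‖ ^ 2 := by positivity
    linarith

/-- The restrictions to `K` of affine functions. -/
noncomputable def restrictAffine (K : Set V) : (V →ᵃ[ℝ] ℝ) →ₗ[ℝ] C(K, ℝ) where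
  toFun f := ⟨fun x => f x, f.continuous_of_finiteDimensional.comp continuous_subtype_val⟩
  map_add' _ _ := rfl
  map_smul' _ _ := rfl

theorem restrictAffine_apply (K : Set V) (f : V →ᵃ[ℝ] ℝ) (x : K) :
    restrictAffine K f x = f x := rfl

theorem exists_dual_of_exposes {K : Set V} (hcomp : IsCompact K) (hconv : Convex ℝ K)
    (H : ∀ f g : V →ᵃ[ℝ] ℝ, (∀ x ∈ K, 0 ≤ f x ∧ f x ≤ 1) → (∀ x ∈ K, 0 ≤ g x ∧ g x ≤ 1) →
      ∃ h : V →ᵃ[ℝ] ℝ, ∀ x ∈ K,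
        0 ≤ h x ∧ h x ≤ f x ∧ h x ≤ g x ∧ f x + g x - h x ≤ 1)
    {p : V} {φ : V →ᵃ[ℝ] ℝ} (hp : Exposes K φ p) :
    ∃ u : V →ᵃ[ℝ] ℝ, u p = 1 ∧ ∀ q ∈ K.extremePoints ℝ, q ≠ p → u q = 0 := by
  have : CompactSpace K := isCompact_iff_compactSpace.1 hcomp
  have hA : Compatible (LinearMap.range (restrictAffine K)) := by
    rintro _ ⟨f, rfl⟩ _ ⟨g, rfl⟩ hf hg
    obtain ⟨h, hh⟩ := H f g (fun x hx => hf ⟨x, hx⟩) (fun x hx => hg ⟨x, hx⟩)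
    exact ⟨_, ⟨h, rfl⟩, fun x => hh x x.2⟩
  obtain ⟨_, ⟨u, rfl⟩, hu0, hup, hu1, hug⟩ := hA.exists_peak
    ⟨AffineMap.const ℝ V 1, rfl⟩ (p := ⟨p, hp.1⟩) ⟨φ, rfl⟩
    (fun x hx => hp.2 x x.2 fun h => hx (Subtype.ext h))
  simp only [restrictAffine_apply] at hu0 hup hu1
  refine ⟨u, hup, fun q hq hqp => ?_⟩
  have hqK : q ∈ K := hq.1
  by_contra hne
  have ht0 : 0 < u q := lt_of_le_of_ne (hu0 ⟨q, hqK⟩) (Ne.symm hne)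
  have ht1 : u q < 1 := hu1 ⟨q, hqK⟩ fun h => hqp (congrArg Subtype.val h)
  have hs : 0 < 1 - u q := by linarith
  let z : V := (1 - u q)⁻¹ • (q - u q • p)
  have hqz : u q • p + (1 - u q) • z = q := by
    simp only [z]
    rw [smul_inv_smul₀ hs.ne']; abel
  have hz : z ∈ K := by
    by_contra hz
    obtain ⟨ψ, c, hψz, hψK⟩ := geometric_hahn_banach_point_closed hconv hcomp.isClosed hz
    have := hug _ ⟨ψ.toLinearMap.toAffineMap - AffineMap.const ℝ V c, rfl⟩
      (fun x => by
        have := hψK x x.2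
        simp only [restrictAffine_apply, AffineMap.coe_sub, Pi.sub_apply,
          LinearMap.coe_toAffineMap, ContinuousLinearMap.coe_coe, AffineMap.const_apply]
        linarith) ⟨q, hqK⟩
    simp only [restrictAffine_apply, AffineMap.coe_sub, Pi.sub_apply,
      LinearMap.coe_toAffineMap, ContinuousLinearMap.coe_coe, AffineMap.const_apply] at this
    have hq' : ψ q = u q * ψ p + (1 - u q) * ψ z := by
      conv_lhs => rw [← hqz]
      simp
    nlinarith
  exact hqp (hq.2 hp.1 hz ⟨u q, 1 - u q, ht0, hs, by ring, hqz⟩).symm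

theorem affineIndependent_extremePoints {K : Set V} (hcomp : IsCompact K) (hconv : Convex ℝ K)
    (H : ∀ f g : V →ᵃ[ℝ] ℝ, (∀ x ∈ K, 0 ≤ f x ∧ f x ≤ 1) → (∀ x ∈ K, 0 ≤ g x ∧ g x ≤ 1) →
      ∃ h : V →ᵃ[ℝ] ℝ, ∀ x ∈ K,
        0 ≤ h x ∧ h x ≤ f x ∧ h x ≤ g x ∧ f x + g x - h x ≤ 1) :
    AffineIndependent ℝ (Subtype.val : K.extremePoints ℝ → V) := by
  let E : Set V := {p | ∃ φ, Exposes K φ p}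
  have hE : ∀ p ∈ E, ∃ u : V →ᵃ[ℝ] ℝ, u p = 1 ∧ ∀ q ∈ K.extremePoints ℝ, q ≠ p → u q = 0 :=
    fun p ⟨_, hp⟩ => exists_dual_of_exposes hcomp hconv H hp
  have hEx : E ⊆ K.extremePoints ℝ := fun p ⟨_, hp⟩ => hp.mem_extremePoints
  have hEi : AffineIndependent ℝ (Subtype.val : E → V) := affineIndependent_of_dual fun p hp =>
    (hE p hp).imp fun u hu => ⟨hu.1, fun q hq => hu.2 q (hEx hq)⟩
  have hfin : E.Finite := finite_set_of_fin_dim_affineIndependent ℝ hEi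
  choose! u hu1 hu0 using hE
  refine affineIndependent_of_dual fun p hp => ⟨u p, ?_⟩
  suffices h : p ∈ E from ⟨hu1 p h, hu0 p h⟩
  by_contra hpE
  let g : V →ᵃ[ℝ] ℝ := AffineMap.const ℝ V 1 - ∑ e ∈ hfin.toFinset, u e
  have hg : ∀ x, g x = 1 - ∑ e ∈ hfin.toFinset, u e x := fun x => by
    have : (∑ e ∈ hfin.toFinset, u e) x = ∑ e ∈ hfin.toFinset, u e x := by
      induction hfin.toFinset using Finset.cons_induction with
      | empty => simp
      | cons a s ha ih => simp [Finset.sum_cons, ih]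
    simp [g, this]
  have hgp : 0 < g p := by
    rw [hg, Finset.sum_eq_zero]
    · norm_num
    · intro e he
      rw [Set.Finite.mem_toFinset] at he
      exact hu0 e he p hp fun h => hpE (h ▸ he)
  obtain ⟨q, φ, hq, hgq⟩ := exists_exposed_pos hcomp g hp.1 hgp
  have hqE : q ∈ E := ⟨φ, hq⟩
  rw [hg, Finset.sum_eq_single q, hu1 q hqE] at hgq
  · norm_num at hgq
  · intro e he hne
    rw [Set.Finite.mem_toFinset] at he
    exact hu0 e he q (hEx hqE) hne.symm
  · exact fun h => absurd (hfin.mem_toFinset.2 hqE) h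

/-- A real function on an affinely independent set extends to an affine function. -/
theorem exists_affineMap_extension {S : Set V}
    (hS : AffineIndependent ℝ (Subtype.val : S → V)) (c : V → ℝ) :
    ∃ h : V →ᵃ[ℝ] ℝ, ∀ x ∈ S, h x = c x := by
  obtain ⟨t, hSt, hti, hts⟩ := exists_subset_affineIndependent_affineSpan_eq_top hS
  have hfin : t.Finite := finite_set_of_fin_dim_affineIndependent ℝ hti
  have := hfin.fintype
  let b : AffineBasis t ℝ V := ⟨Subtype.val, hti, by simpa using hts⟩
  refine ⟨∑ i : t, c i • b.coord i, fun x hx => ?_⟩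
  have hsum : ∀ s : Finset t, (∑ i ∈ s, c i • b.coord i) x = ∑ i ∈ s, c i * b.coord i x := by
    intro s
    induction s using Finset.cons_induction with
    | empty => simp
    | cons a s ha ih => simp [Finset.sum_cons, ih]
  have hbx : b ⟨x, hSt hx⟩ = x := rfl
  rw [hsum, Finset.sum_eq_single ⟨x, hSt hx⟩]
  · have := b.coord_apply_eq ⟨x, hSt hx⟩
    rw [hbx] at this
    rw [this, mul_one]
  · intro i _ hi
    have := b.coord_apply_ne hi
    rw [hbx] at this
    rw [this, mul_zero]
  · exact fun h => absurd (Finset.mem_univ _) h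

theorem affineMap_nonneg_of_extremePoints {K : Set V} (hcomp : IsCompact K) (hconv : Convex ℝ K)
    (a : V →ᵃ[ℝ] ℝ) (ha : ∀ x ∈ K.extremePoints ℝ, 0 ≤ a x) : ∀ x ∈ K, 0 ≤ a x := by
  have hsub : closure (convexHull ℝ (K.extremePoints ℝ)) ⊆ a ⁻¹' Set.Ici 0 :=
    closure_minimal (convexHull_min ha ((convex_Ici 0).affine_preimage a))
      (isClosed_Ici.preimage a.continuous_of_finiteDimensional)
  rw [closure_convexHull_extremePoints hcomp hconv] at hsub
  exact hsub

theorem exists_joint_of_affineIndependent {K : Set V} (hcomp : IsCompact K) (hconv : Convex ℝ K)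
    (hK : AffineIndependent ℝ (Subtype.val : K.extremePoints ℝ → V)) (f g : V →ᵃ[ℝ] ℝ)
    (hf : ∀ x ∈ K, 0 ≤ f x ∧ f x ≤ 1) (hg : ∀ x ∈ K, 0 ≤ g x ∧ g x ≤ 1) :
    ∃ h : V →ᵃ[ℝ] ℝ, ∀ x ∈ K,
      0 ≤ h x ∧ h x ≤ f x ∧ h x ≤ g x ∧ f x + g x - h x ≤ 1 := by
  obtain ⟨h, hh⟩ := exists_affineMap_extension hK fun x => min (f x) (g x)
  have h0 := affineMap_nonneg_of_extremePoints hcomp hconv h fun x hx => by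
    rw [hh x hx]; exact le_min (hf x hx.1).1 (hg x hx.1).1
  have h1 := affineMap_nonneg_of_extremePoints hcomp hconv (f - h) fun x hx => by
    simp [hh x hx]
  have h2 := affineMap_nonneg_of_extremePoints hcomp hconv (g - h) fun x hx => by
    simp [hh x hx]
  have h3 := affineMap_nonneg_of_extremePoints hcomp hconv
    (AffineMap.const ℝ V 1 - (f + g - h)) fun x hx => by
      have := (hf x hx.1).2
      have := (hg x hx.1).2
      simp only [AffineMap.coe_sub, AffineMap.coe_add, Pi.sub_apply, Pi.add_apply,
        AffineMap.const_apply, hh x hx]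
      rcases min_cases (f x) (g x) with h | h <;> linarith
  refine ⟨h, fun x hx => ⟨h0 x hx, ?_, ?_, ?_⟩⟩
  · simpa using h1 x hx
  · simpa using h2 x hx
  · have := h3 x hx
    simp only [AffineMap.coe_sub, AffineMap.coe_add, Pi.sub_apply, Pi.add_apply,
        AffineMap.const_apply] at this
    linarith

end Convex

end JointEffects


/-- every pair of effects on a nonempty compact convex set `K` is
compatible (admits a joint effect `h` with `0 ≤ h`, `h ≤ f`, `h ≤ g`, and
`f + g − h ≤ 1` on `K`) if and only if the set of extreme points of `K` is affinely
independent, i.e., iff `K` is a simplex. -/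
theorem all_effects_compatible_iff_simplex
    {V : Type*} [NormedAddCommGroup V] [NormedSpace ℝ V] [FiniteDimensional ℝ V]
    (K : Set V) (hne : K.Nonempty) (hcomp : IsCompact K) (hconv : Convex ℝ K) :
    (∀ f g : V →ᵃ[ℝ] ℝ, (∀ x ∈ K, 0 ≤ f x ∧ f x ≤ 1) → (∀ x ∈ K, 0 ≤ g x ∧ g x ≤ 1) →
      ∃ h : V →ᵃ[ℝ] ℝ, ∀ x ∈ K,
        0 ≤ h x ∧ h x ≤ f x ∧ h x ≤ g x ∧ f x + g x - h x ≤ 1) ↔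
    AffineIndependent ℝ (Subtype.val : Set.extremePoints ℝ K → V) := by
  exact ⟨JointEffects.affineIndependent_extremePoints hcomp hconv,
    JointEffects.exists_joint_of_affineIndependent hcomp hconv⟩
end
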